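/- arXiv:1503.00469 — 2 statements merged into one kernel-verified Lean document; each statement's English description precedes it below -/
import Mathlib

section
/- For every α ∈ (0,1) there exist R > 0, ν > 0, β ∈ (α,1), a continuous function λ : (−ν,ν) → (0,∞) with λ(0) = 1, and 2π-periodic even functions v_a ∈ C^{1,β}(ℝ) for a ∈ (−ν,ν) with ∫_0^{2π} v_a(σ) cos σ dσ = 0 and with ‖v_a‖_{C^{1,β}(ℝ)} → 0 as a → 0, such that, setting u_a(s) = R + (a/λ(a)) ( cos(λ(a) s) + v_a(λ(a) s) ), the following hold for every a ∈ (−ν,ν): u_a > 0 everywhere; for every s ∈ ℝ the limits defining H(u_a)(s) exist and H(u_a)(s) = h_R, where h_R = −2 ∫_ℝ ( F(2R/|t|) − F(+∞) ) |t|^{−1−α} dt > 0 is a positive constant depending only on α; if a ≠ 0 then the minimal positive period of u_a is 2π/λ(a); and u_a and u_{a'} are not identically equal whenever a ≠ a'. -/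
open MeasureTheory Filter Topology Classical Real

/-- `F(q) = ∫_0^q (1+τ²)^{−(2+α)/2} dτ`. -/
noncomputable def Fa (α q : ℝ) : ℝ := ∫ τ in (0:ℝ)..q, (1 + τ ^ 2) ^ (-(2 + α) / 2)

/-- `F(+∞) = ∫_0^∞ (1+τ²)^{−(2+α)/2} dτ`. -/
noncomputable def FaInf (α : ℝ) : ℝ := ∫ τ in Set.Ioi (0:ℝ), (1 + τ ^ 2) ^ (-(2 + α) / 2)

/-- `H(u)(s) = h`: the limits in the graph formula for the nonlocal mean curvature of the band
`{(s₁,s₂) : −u(s₁) < s₂ < u(s₁)}` at the boundary point `(s, u(s))` exist, and their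
combination equals `h`:
`h = 2 lim_{ε→0} ∫_{|t|≥ε} F((u(s)−u(s−t))/|t|) |t|^{−1−α} dt
   − 2 ∫_ℝ (F((u(s)+u(s−t))/|t|) − F(∞)) |t|^{−1−α} dt`. -/
def HasNMC (α : ℝ) (u : ℝ → ℝ) (s h : ℝ) : Prop :=
  ∃ I : ℝ,
    Tendsto (fun ε : ℝ => ∫ t in {t : ℝ | ε ≤ |t|},
        Fa α ((u s - u (s - t)) / |t|) * |t| ^ (-(1 + α))) (𝓝[>] (0:ℝ)) (𝓝 I) ∧
    Integrable (fun t : ℝ => (Fa α ((u s + u (s - t)) / |t|) - FaInf α) * |t| ^ (-(1 + α))) ∧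
    h = 2 * I - 2 * ∫ t : ℝ, (Fa α ((u s + u (s - t)) / |t|) - FaInf α) * |t| ^ (-(1 + α))


namespace DB

set_option linter.unusedSectionVars false
set_option linter.deprecated false

noncomputable section

abbrev LZ : Type := ↥(lp (fun _ : ℤ => ℂ) 1)
abbrev V : Type := ↥(lp (fun _ : ℕ => ℝ) 1)
abbrev A : Type := LZ →L[ℝ] LZ

section lift
variable {ι E W : Type*} [NormedAddCommGroup E] [NormedSpace ℝ E]
  [NormedAddCommGroup W] [NormedSpace ℝ W] [CompleteSpace W]

theorem l1_summable (c : lp (fun _ : ι => E) 1) : Summable fun i => ‖c i‖ := by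
  have := (lp.memℓp c).summable (by norm_num)
  simpa using this

theorem l1_norm (c : lp (fun _ : ι => E) 1) : ‖c‖ = ∑' i, ‖c i‖ := by
  have := lp.norm_eq_tsum_rpow (p := 1) (by norm_num) c
  simpa using this

theorem lift_bd (B : ι → E →L[ℝ] W) (C : ℝ) (h : ∀ i, ‖B i‖ ≤ C) (c : lp (fun _ : ι => E) 1) (i : ι) :
    ‖B i (c i)‖ ≤ C * ‖c i‖ :=
  (B i).le_of_opNorm_le (h i) _

theorem lift_summable (B : ι → E →L[ℝ] W) (C : ℝ) (h : ∀ i, ‖B i‖ ≤ C) (c : lp (fun _ : ι => E) 1) :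
    Summable fun i => B i (c i) :=
  Summable.of_norm_bounded ((l1_summable c).mul_left C) (lift_bd B C h c)

def lift (B : ι → E →L[ℝ] W) (C : ℝ) (h : ∀ i, ‖B i‖ ≤ C) : lp (fun _ : ι => E) 1 →L[ℝ] W :=
  LinearMap.mkContinuous
    { toFun := fun c => ∑' i, B i (c i)
      map_add' := fun c d => by
        rw [← (lift_summable B C h c).tsum_add (lift_summable B C h d)]
        simp
      map_smul' := fun r c => by
        rw [RingHom.id_apply, ← (lift_summable B C h c).tsum_const_smul]
        simp }
    C (fun c => by
      simp only [LinearMap.coe_mk, AddHom.coe_mk]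
      rw [l1_norm, ← tsum_mul_left]
      exact tsum_of_norm_bounded ((l1_summable c).mul_left C).hasSum (lift_bd B C h c))

theorem lift_hasSum (B : ι → E →L[ℝ] W) (C : ℝ) (h : ∀ i, ‖B i‖ ≤ C) (c : lp (fun _ : ι => E) 1) :
    HasSum (fun i => B i (c i)) (lift B C h c) :=
  (lift_summable B C h c).hasSum

theorem lift_norm (B : ι → E →L[ℝ] W) (C : ℝ) (h : ∀ i, ‖B i‖ ≤ C) (c : lp (fun _ : ι => E) 1) :
    ‖lift B C h c‖ ≤ C * ‖c‖ := by
  rw [l1_norm, ← tsum_mul_left]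
  exact tsum_of_norm_bounded ((l1_summable c).mul_left C).hasSum (lift_bd B C h c)

theorem lift_opNorm (B : ι → E →L[ℝ] W) (C : ℝ) (h : ∀ i, ‖B i‖ ≤ C) (hC : 0 ≤ C) :
    ‖lift B C h‖ ≤ C :=
  ContinuousLinearMap.opNorm_le_bound _ hC (lift_norm B C h)

theorem lift_single [DecidableEq ι] (B : ι → E →L[ℝ] W) (C : ℝ) (h : ∀ i, ‖B i‖ ≤ C) (i : ι) (x : E) :
    lift B C h (lp.single 1 i x) = B i x := by
  refine (lift_hasSum B C h _).unique ?_
  convert hasSum_ite_eq i (B i x) using 2 with j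
  by_cases hj : j = i
  · subst hj; simp
  · simp [hj]

theorem l1_ext [DecidableEq ι] {S T : lp (fun _ : ι => E) 1 →L[ℝ] W}
    (h : ∀ i x, S (lp.single 1 i x) = T (lp.single 1 i x)) : S = T := by
  ext c
  have hc := lp.hasSum_single (p := 1) (by norm_num) c
  have h1 := S.hasSum hc
  have h2 := T.hasSum hc
  simp only [h] at h1
  exact h1.unique h2

end lift

theorem single_norm {ι E : Type*} [NormedAddCommGroup E] [DecidableEq ι] (i : ι) (x : E) :
    ‖(lp.single 1 i x : lp (fun _ : ι => E) 1)‖ = ‖x‖ :=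
  lp.norm_single (E := fun _ => E) (p := 1) (by norm_num) i x

/-- lift for real coefficients -/
def rlift {W : Type*} [NormedAddCommGroup W] [NormedSpace ℝ W] [CompleteSpace W]
    (b : ℕ → W) (C : ℝ) (h : ∀ k, ‖b k‖ ≤ C) : V →L[ℝ] W :=
  lift (fun k => ContinuousLinearMap.toSpanSingleton ℝ (b k)) C (fun k => by simpa using h k)

section rl
variable {W : Type*} [NormedAddCommGroup W] [NormedSpace ℝ W] [CompleteSpace W]
    (b : ℕ → W) (C : ℝ) (h : ∀ k, ‖b k‖ ≤ C)

theorem rlift_hasSum (c : V) : HasSum (fun k => c k • b k) (rlift b C h c) := by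
  have := lift_hasSum (fun k => ContinuousLinearMap.toSpanSingleton ℝ (b k)) C (fun k => by simpa using h k) c
  simp only [ContinuousLinearMap.toSpanSingleton_apply] at this
  exact this

theorem rlift_norm (c : V) : ‖rlift b C h c‖ ≤ C * ‖c‖ := lift_norm _ _ _ _

theorem rlift_single (k : ℕ) (x : ℝ) : rlift b C h (lp.single 1 k x) = x • b k := by
  rw [rlift, lift_single]; simp [ContinuousLinearMap.toSpanSingleton_apply]

theorem V_ext {S T : V →L[ℝ] W}
    (h : ∀ k, S (lp.single 1 k 1) = T (lp.single 1 k 1)) : S = T := by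
  refine l1_ext fun k x => ?_
  have : (lp.single 1 k x : V) = x • lp.single 1 k 1 := by
    rw [← lp.single_smul]; simp
  rw [this, map_smul, map_smul, h]
end rl

/-! ### weights and multiplication operators -/

def wt (k : ℤ) : ℝ := 2 ^ k.natAbs

theorem wt_pos (k : ℤ) : 0 < wt k := by unfold wt; positivity
theorem wt_one_le (k : ℤ) : 1 ≤ wt k := one_le_pow₀ (by norm_num)
theorem wt_add (j k : ℤ) : wt (j + k) ≤ wt j * wt k := by
  unfold wt; rw [← pow_add]
  exact pow_le_pow_right₀ (by norm_num) (Int.natAbs_add_le j k)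
theorem wt_neg (k : ℤ) : wt (-k) = wt k := by simp [wt]
theorem wt_nat (k : ℕ) : wt k = 2 ^ k := by simp [wt]

def singleL (k : ℤ) : ℂ →L[ℝ] LZ := lp.singleContinuousLinearMap ℝ (fun _ : ℤ => ℂ) 1 k

theorem singleL_apply (k : ℤ) (z : ℂ) : singleL k z = lp.single 1 k z := rfl

theorem singleL_norm (k : ℤ) (z : ℂ) : ‖singleL k z‖ = ‖z‖ := by
  rw [singleL_apply]; exact single_norm (E := ℂ) k z

/-- multiplication by a complex number as a real-linear map -/
def cmul (z : ℂ) : ℂ →L[ℝ] ℂ := ContinuousLinearMap.mul ℝ ℂ z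

theorem U_bd (k : ℤ) (z : ℂ) (j : ℤ) :
    ‖(singleL (j + k)).comp (cmul (z * ((wt (j + k) / wt j : ℝ) : ℂ)))‖ ≤ ‖z‖ * wt k := by
  refine ContinuousLinearMap.opNorm_le_bound _ (mul_nonneg (norm_nonneg _) (wt_pos k).le) fun y => ?_
  rw [ContinuousLinearMap.comp_apply, singleL_norm]
  simp only [cmul, ContinuousLinearMap.mul_apply', norm_mul, Complex.norm_real, Real.norm_eq_abs]
  gcongr
  rw [abs_of_pos (div_pos (wt_pos _) (wt_pos _)), div_le_iff₀ (wt_pos _), mul_comm]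
  exact wt_add j k

/-- multiplication by `z e^{ikσ}` -/
def U (k : ℤ) (z : ℂ) : A := lift _ _ (U_bd k z)

theorem U_single (k : ℤ) (z : ℂ) (j : ℤ) (y : ℂ) :
    U k z (lp.single 1 j y) = lp.single 1 (j + k) (z * ((wt (j + k) / wt j : ℝ) : ℂ) * y) := by
  rw [U, lift_single]; rfl

theorem U_norm (k : ℤ) (z : ℂ) : ‖U k z‖ ≤ ‖z‖ * wt k :=
  lift_opNorm _ _ _ (mul_nonneg (norm_nonneg _) (wt_pos k).le)

theorem U_add (k : ℤ) (z z' : ℂ) : U k (z + z') = U k z + U k z' := by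
  refine l1_ext fun j y => ?_
  rw [ContinuousLinearMap.add_apply, U_single, U_single, U_single, ← lp.single_add]
  congr 1; ring

theorem U_smul (k : ℤ) (r : ℝ) (z : ℂ) : U k (r • z) = r • U k z := by
  refine l1_ext fun j y => ?_
  rw [ContinuousLinearMap.smul_apply, U_single, U_single, ← lp.single_smul]
  congr 1; simp [mul_assoc]

def Wl (k : ℕ) : ℂ →ₗ[ℝ] A where
  toFun z := (1 / 2 : ℝ) • (U k z + U (-k) (starRingEnd ℂ z))
  map_add' z z' := by rw [map_add, U_add, U_add]; module
  map_smul' r z := by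
    have : starRingEnd ℂ (r • z) = r • starRingEnd ℂ z := by simp
    rw [this, U_smul, U_smul, RingHom.id_apply]; module

/-- multiplication by `Re (z e^{ikσ})` -/
def Wk (k : ℕ) : ℂ →L[ℝ] A := (Wl k).mkContinuous (2 ^ k) (fun z => by
  have h1 := U_norm k z
  have h2 := U_norm (-k) (starRingEnd ℂ z)
  rw [wt_neg, wt_nat, Complex.norm_conj] at h2
  rw [wt_nat] at h1
  calc ‖Wl k z‖ ≤ (1 / 2) * (‖U k z‖ + ‖U (-k) (starRingEnd ℂ z)‖) := by
        simp only [Wl, LinearMap.coe_mk, AddHom.coe_mk]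
        rw [norm_smul, Real.norm_of_nonneg (by norm_num)]
        gcongr
        exact norm_add_le _ _
    _ ≤ 2 ^ k * ‖z‖ := by linarith)

theorem Wk_apply (k : ℕ) (z : ℂ) : Wk k z = (1 / 2 : ℝ) • (U k z + U (-k) (starRingEnd ℂ z)) := rfl

theorem Wk_norm (k : ℕ) (z : ℂ) : ‖Wk k z‖ ≤ 2 ^ k * ‖z‖ :=
  (Wk k).le_of_opNorm_le (LinearMap.mkContinuous_norm_le _ (by positivity) _) z

/-! ### evaluation -/

def ek (k : ℤ) (σ : ℝ) : ℂ := Complex.exp ((k * σ : ℝ) * Complex.I)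

theorem ek_norm (k : ℤ) (σ : ℝ) : ‖ek k σ‖ = 1 := by
  rw [ek, Complex.norm_exp_ofReal_mul_I]

theorem ek_add (j k : ℤ) (σ : ℝ) : ek (j + k) σ = ek j σ * ek k σ := by
  rw [ek, ek, ek, ← Complex.exp_add]; congr 1; push_cast; ring

theorem ek_conj (k : ℤ) (σ : ℝ) : ek (-k) σ = starRingEnd ℂ (ek k σ) := by
  rw [ek, ek, ← Complex.exp_conj]; congr 1; simp

theorem ev_bd (σ : ℝ) (k : ℤ) : ‖cmul (ek k σ * (((wt k)⁻¹ : ℝ) : ℂ))‖ ≤ 1 := by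
  refine ContinuousLinearMap.opNorm_le_bound _ (by norm_num) fun y => ?_
  simp only [cmul, ContinuousLinearMap.mul_apply', norm_mul, Complex.norm_real, Real.norm_eq_abs, ek_norm]
  gcongr
  rw [one_mul, abs_of_pos (inv_pos.2 (wt_pos _))]
  exact inv_le_one_of_one_le₀ (wt_one_le k)

def ev (σ : ℝ) : LZ →L[ℝ] ℂ := lift _ _ (ev_bd σ)

theorem ev_single (σ : ℝ) (k : ℤ) (y : ℂ) :
    ev σ (lp.single 1 k y) = ek k σ * (((wt k)⁻¹ : ℝ) : ℂ) * y := by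
  rw [ev, lift_single]; rfl

theorem ev_U (σ : ℝ) (k : ℤ) (z : ℂ) (y : LZ) : ev σ (U k z y) = z * ek k σ * ev σ y := by
  have : (ev σ).comp (U k z) = (cmul (z * ek k σ)).comp (ev σ) := by
    refine l1_ext fun j y => ?_
    rw [ContinuousLinearMap.comp_apply, ContinuousLinearMap.comp_apply, U_single, ev_single, ev_single]
    simp only [cmul, ContinuousLinearMap.mul_apply', ek_add]
    have h1 : ((wt j : ℝ) : ℂ) ≠ 0 := by exact_mod_cast (wt_pos j).ne'
    have h2 : ((wt (j + k) : ℝ) : ℂ) ≠ 0 := by exact_mod_cast (wt_pos _).ne'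
    push_cast
    field_simp
  exact congrArg (fun T => T y) this

theorem ev_W (σ : ℝ) (k : ℕ) (z : ℂ) (y : LZ) :
    ev σ (Wk k z y) = ((z * ek k σ).re : ℂ) * ev σ y := by
  rw [Wk_apply, ContinuousLinearMap.smul_apply, ContinuousLinearMap.add_apply, map_smul, map_add,
    ev_U, ev_U, ek_conj, ← add_mul, ← map_mul, Complex.add_conj, Complex.real_smul]
  push_cast
  ring

/-- projection onto real cosine coefficients -/
def Pi0 : LZ →L[ℝ] V :=
  lift (fun k : ℤ => (lp.singleContinuousLinearMap ℝ (fun _ : ℕ => ℝ) 1 k.natAbs).comp Complex.reCLM) 1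
    (fun k => by
      refine ContinuousLinearMap.opNorm_le_bound _ (by norm_num) fun y => ?_
      rw [ContinuousLinearMap.comp_apply, lp.singleContinuousLinearMap_apply]
      rw [single_norm (E := ℝ), one_mul]
      exact Complex.abs_re_le_norm y)

theorem Pi0_single (k : ℤ) (y : ℂ) : Pi0 (lp.single 1 k y) = lp.single 1 k.natAbs y.re := by
  rw [Pi0, lift_single]; rfl

def evV (σ : ℝ) : V →L[ℝ] ℝ := rlift (fun k => cos (k * σ) / 2 ^ k) 1 (fun k => by
  rw [Real.norm_eq_abs, abs_div, abs_of_pos (by positivity : (0:ℝ) < 2 ^ k)]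
  exact div_le_one_of_le₀ ((abs_cos_le_one _).trans (one_le_pow₀ (by norm_num))) (by positivity))

theorem ek_re (k : ℤ) (σ : ℝ) : (ek k σ).re = cos (k * σ) := by
  rw [ek, Complex.exp_ofReal_mul_I_re]

theorem ek_im (k : ℤ) (σ : ℝ) : (ek k σ).im = sin (k * σ) := by
  rw [ek, Complex.exp_ofReal_mul_I_im]

theorem ev_Pi0 (σ : ℝ) (y : LZ) : (ev σ y + ev (-σ) y).re = 2 * evV σ (Pi0 y) := by
  have : Complex.reCLM.comp (ev σ + ev (-σ)) = (2 : ℝ) • (evV σ).comp Pi0 := by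
    refine l1_ext fun k y => ?_
    have h : cos ((k.natAbs : ℝ) * σ) = cos (k * σ) := by
      rcases Int.natAbs_eq k with h | h
      · conv_rhs => rw [h]
        simp
      · conv_rhs => rw [h]
        simp
    simp only [ContinuousLinearMap.comp_apply, ContinuousLinearMap.add_apply,
      ContinuousLinearMap.smul_apply, ev_single, Pi0_single, evV, rlift_single, h]
    simp only [Complex.reCLM_apply, Complex.add_re, Complex.mul_re, Complex.mul_im, Complex.ofReal_re,
      Complex.ofReal_im, ek_re, ek_im, wt, smul_eq_mul]
    simp
    ring
  exact congrArg (fun T => T y) this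

end
end DB


namespace DB
noncomputable section


/-! ### the Banach algebra of bounded continuous operator-valued functions -/

def BG (𝔸 : Type) [NormedRing 𝔸] : Type := BoundedContinuousFunction (ℝ × ℝ) 𝔸

section BG
variable (𝔸 : Type) [NormedRing 𝔸]
instance instNR : NormedRing (BG 𝔸) := inferInstanceAs (NormedRing (BoundedContinuousFunction (ℝ × ℝ) 𝔸))
instance instNA [NormedAlgebra ℝ 𝔸] : NormedAlgebra ℝ (BG 𝔸) :=
  inferInstanceAs (NormedAlgebra ℝ (BoundedContinuousFunction (ℝ × ℝ) 𝔸))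
instance instCS [CompleteSpace 𝔸] : CompleteSpace (BG 𝔸) :=
  inferInstanceAs (CompleteSpace (BoundedContinuousFunction (ℝ × ℝ) 𝔸))
end BG

abbrev BB : Type := BG A

def BB.at (K : BB) (ω : ℝ × ℝ) : A := (show BoundedContinuousFunction (ℝ × ℝ) A from K) ω

instance : CoeFun BB (fun _ => ℝ × ℝ → A) := ⟨BB.at⟩

@[simp] theorem BB.one_at (ω : ℝ × ℝ) : (1 : BB) ω = 1 := rfl
@[simp] theorem BB.add_at (K L : BB) (ω : ℝ × ℝ) : (K + L) ω = K ω + L ω := rfl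
@[simp] theorem BB.mul_at (K L : BB) (ω : ℝ × ℝ) : (K * L) ω = K ω * L ω := rfl
@[simp] theorem BB.smul_at (r : ℝ) (K : BB) (ω : ℝ × ℝ) : (r • K) ω = r • K ω := rfl
theorem BB.norm_at (K : BB) (ω : ℝ × ℝ) : ‖K ω‖ ≤ ‖K‖ :=
  BoundedContinuousFunction.norm_coe_le_norm (show BoundedContinuousFunction (ℝ × ℝ) A from K) ω
theorem BB.cont (K : BB) : Continuous K.at :=
  (show BoundedContinuousFunction (ℝ × ℝ) A from K).continuous
theorem BB.cont_app (K : BB) (y : LZ) : Continuous fun ω => K ω y :=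
  K.cont.clm_apply continuous_const

def mkBB (f : ℝ × ℝ → A) (hf : Continuous f) (C : ℝ) (hC : ∀ ω, ‖f ω‖ ≤ C) : BB :=
  BoundedContinuousFunction.ofNormedAddCommGroup f hf C hC
@[simp] theorem mkBB_at (f : ℝ × ℝ → A) (hf : Continuous f) (C : ℝ) (hC : ∀ ω, ‖f ω‖ ≤ C) (ω : ℝ × ℝ) :
    mkBB f hf C hC ω = f ω := rfl
theorem BB.norm_le {K : BB} {C : ℝ} (hC0 : 0 ≤ C) (hC : ∀ ω, ‖K ω‖ ≤ C) : ‖K‖ ≤ C :=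
  (BoundedContinuousFunction.norm_le (f := (show BoundedContinuousFunction (ℝ × ℝ) A from K)) hC0).2 hC
theorem mkBB_norm (f : ℝ × ℝ → A) (hf : Continuous f) (C : ℝ) (hC : ∀ ω, ‖f ω‖ ≤ C) :
    ‖mkBB f hf C hC‖ ≤ C :=
  BB.norm_le ((norm_nonneg _).trans (hC 0)) hC

def evalBB (ω : ℝ × ℝ) : BB →L[ℝ] A :=
  LinearMap.mkContinuous { toFun := fun K => K ω, map_add' := fun _ _ => rfl, map_smul' := fun _ _ => rfl } 1
    (fun K => by rw [one_mul]; exact K.norm_at ω)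
theorem evalBB_apply (ω : ℝ × ℝ) (K : BB) : evalBB ω K = K ω := rfl

/-! ### functional calculus -/

theorem BB_one_norm : ‖(1 : BB)‖ ≤ 1 := by
  refine BB.norm_le (by norm_num) fun x => ?_
  exact ContinuousLinearMap.norm_id_le

def e0 : LZ := lp.single 1 0 1
theorem e0_norm : ‖e0‖ = 1 := by rw [e0, single_norm (E := ℂ)]; simp

instance : NormOneClass BB := ⟨by
  refine le_antisymm BB_one_norm ?_
  have h := ((1 : BB) 0).le_of_opNorm_le (BB.norm_at 1 0) e0
  rw [BB.one_at, e0_norm, mul_one] at h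
  exact e0_norm.symm.le.trans h⟩

theorem mem_eball_one {W : Type*} [NormedAddCommGroup W] {b : W} (hb : ‖b‖ < 1) :
    b ∈ Metric.eball (0 : W) 1 := by
  rw [← ENNReal.ofReal_one, Metric.eball_ofReal]
  simpa using hb

section fcalc
variable {𝔸 : Type} [NormedRing 𝔸] [NormedAlgebra ℝ 𝔸] [NormOneClass 𝔸]

/-- `(1+b)^e` -/
def fB (e : ℝ) (b : 𝔸) : 𝔸 := (binomialSeries 𝔸 e).sum b

theorem fB_radius (e : ℝ) : 1 ≤ (binomialSeries 𝔸 e).radius := by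
  refine le_trans (binomialSeries_radius_ge_one (𝕂 := ℝ) (𝔸 := ℝ) (a := e)) ?_
  refine FormalMultilinearSeries.radius_le_of_le fun n => ?_
  rw [binomialSeries, binomialSeries, FormalMultilinearSeries.ofScalars_norm,
    FormalMultilinearSeries.ofScalars_norm]

variable [CompleteSpace 𝔸]
theorem fB_ps (e : ℝ) : HasFPowerSeriesOnBall (fB e) (binomialSeries 𝔸 e) 0 1 :=
  ((binomialSeries 𝔸 e).hasFPowerSeriesOnBall (lt_of_lt_of_le (by norm_num) (fB_radius e))).mono
    (by norm_num) (fB_radius e)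

theorem fB_hasSum (e : ℝ) (b : 𝔸) (hb : ‖b‖ < 1) :
    HasSum (fun n => Ring.choose e n • b ^ n) (fB e b) := by
  have h := (fB_ps e).hasSum (y := b) (mem_eball_one hb)
  simpa [binomialSeries, FormalMultilinearSeries.ofScalars_apply_eq] using h

theorem fB_zero (e : ℝ) : fB e (0 : 𝔸) = 1 := by
  have := (fB_ps (𝔸 := 𝔸) e).coeff_zero (fun _ => 0)
  simpa [binomialSeries, FormalMultilinearSeries.ofScalars] using this.symm

theorem fB_contDiffAt (e : ℝ) : ContDiffAt ℝ 1 (fB (𝔸 := 𝔸) e) 0 :=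
  (fB_ps e).analyticAt.contDiffAt

theorem fB_deriv (e : ℝ) : HasFDerivAt (fB (𝔸 := 𝔸) e) (e • ContinuousLinearMap.id ℝ 𝔸) 0 := by
  have := (fB_ps (𝔸 := 𝔸) e).hasFPowerSeriesAt.hasFDerivAt
  have h2 : (continuousMultilinearCurryFin1 ℝ 𝔸 𝔸) (binomialSeries 𝔸 e 1)
      = e • ContinuousLinearMap.id ℝ 𝔸 := by
    ext1 x
    simp [binomialSeries, FormalMultilinearSeries.ofScalars]
  rwa [h2] at this

end fcalc

/-! ### multiplication predicate -/

def IsMul (σ : ℝ) (K : BB) (t : ℝ × ℝ → ℝ) : Prop :=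
  ∀ ω y, ev σ (K ω y) = (t ω : ℂ) * ev σ y

theorem IsMul.one (σ : ℝ) : IsMul σ 1 (fun _ => 1) := fun ω y => by simp
theorem IsMul.add {σ : ℝ} {K L : BB} {s t : ℝ × ℝ → ℝ} (h : IsMul σ K s) (h' : IsMul σ L t) :
    IsMul σ (K + L) (fun ω => s ω + t ω) := fun ω y => by
  simp [h ω y, h' ω y, add_mul]
theorem IsMul.smul {σ : ℝ} {K : BB} {s : ℝ × ℝ → ℝ} (h : IsMul σ K s) (r : ℝ) :
    IsMul σ (r • K) (fun ω => r * s ω) := fun ω y => by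
  simp [h ω y, mul_assoc]
theorem IsMul.mul {σ : ℝ} {K L : BB} {s t : ℝ × ℝ → ℝ} (h : IsMul σ K s) (h' : IsMul σ L t) :
    IsMul σ (K * L) (fun ω => s ω * t ω) := fun ω y => by
  simp [h ω _, h' ω y, mul_assoc]
theorem IsMul.pow {σ : ℝ} {K : BB} {s : ℝ × ℝ → ℝ} (h : IsMul σ K s) (n : ℕ) :
    IsMul σ (K ^ n) (fun ω => s ω ^ n) := by
  induction n with
  | zero => simpa using IsMul.one σ
  | succ n ih => simpa [pow_succ] using ih.mul h

theorem ev_e0 (σ : ℝ) : ev σ e0 = 1 := by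
  rw [e0, ev_single]; simp [ek, wt]
theorem ev_norm (σ : ℝ) (y : LZ) : ‖ev σ y‖ ≤ ‖y‖ := by
  have := lift_norm _ _ (ev_bd σ) y
  rwa [one_mul] at this

theorem IsMul.bound {σ : ℝ} {K : BB} {t : ℝ × ℝ → ℝ} (h : IsMul σ K t) (ω : ℝ × ℝ) : |t ω| ≤ ‖K‖ := by
  have h1 := h ω e0
  rw [ev_e0, mul_one] at h1
  calc |t ω| = ‖(t ω : ℂ)‖ := by simp
    _ = ‖ev σ (K ω e0)‖ := by rw [h1]
    _ ≤ ‖K ω e0‖ := ev_norm _ _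
    _ ≤ ‖K ω‖ * ‖e0‖ := (K ω).le_opNorm _
    _ ≤ ‖K‖ := by rw [e0_norm, mul_one]; exact K.norm_at ω


theorem IsMul.fB {σ : ℝ} {K : BB} {t : ℝ × ℝ → ℝ} (h : IsMul σ K t) (hK : ‖K‖ < 1) (e : ℝ) :
    IsMul σ (fB e K) (fun ω => (1 + t ω) ^ e) := by
  intro ω y
  have h1 := fB_hasSum e K hK
  have h2 := ((ev σ).comp ((ContinuousLinearMap.apply ℝ LZ y).comp (evalBB ω))).hasSum h1
  have h3 : HasSum (fun n => Ring.choose e n * t ω ^ n) ((1 + t ω) ^ e) := by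
    have := (Real.one_add_rpow_hasFPowerSeriesOnBall_zero (a := e)).hasSum (y := t ω) (mem_eball_one ((h.bound ω).trans_lt hK))
    simpa [binomialSeries, mul_comm] using this
  have h4 := (Complex.hasSum_ofReal.2 h3).mul_right (ev σ y)
  refine h2.unique ?_
  refine h4.congr_fun ?_
  intro n
  have h5 := (h.pow n) ω y
  simp only [Function.comp, map_smul, ContinuousLinearMap.comp_apply, ContinuousLinearMap.apply_apply]
  rw [show evalBB ω (K ^ n) = (K ^ n) ω from rfl, h5]
  simp [mul_assoc]

/-! ### integral operators -/

def mu : Measure (ℝ × ℝ) := (volume : Measure ℝ).prod ((volume : Measure ℝ).restrict (Set.Icc 0 1))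

instance : SFinite mu := by unfold mu; infer_instance

theorem Iop_int {lam : ℝ × ℝ → ℝ} (hl : Integrable lam mu) (C : LZ) (K : BB) :
    Integrable (fun ω => lam ω • K ω C) mu := by
  have hc : Continuous fun ω => K ω C := K.cont_app C
  refine Integrable.mono' (hl.norm.mul_const (‖K‖ * ‖C‖)) (hl.1.smul hc.aestronglyMeasurable) ?_
  refine Eventually.of_forall fun ω => ?_
  rw [norm_smul]
  gcongr
  exact (K ω).le_of_opNorm_le (K.norm_at ω) _

def Iop (lam : ℝ × ℝ → ℝ) (hl : Integrable lam mu) (C : LZ) : BB →L[ℝ] LZ :=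
  LinearMap.mkContinuous
    { toFun := fun K : BB => ∫ ω, lam ω • K ω C ∂mu
      map_add' := fun K L => by
        rw [← integral_add (Iop_int hl C K) (Iop_int hl C L)]
        simp
      map_smul' := fun r K => by
        rw [RingHom.id_apply, ← integral_smul]
        congr 1; ext1 ω
        simp [smul_comm (lam ω) r] }
    ((∫ ω, ‖lam ω‖ ∂mu) * ‖C‖) (fun K => by
      simp only [LinearMap.coe_mk, AddHom.coe_mk]
      calc _ ≤ ∫ ω, ‖lam ω‖ * (‖K‖ * ‖C‖) ∂mu := by
            refine norm_integral_le_of_norm_le (hl.norm.mul_const _) (Eventually.of_forall fun ω => ?_)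
            rw [norm_smul]
            gcongr
            exact (K ω).le_of_opNorm_le (K.norm_at ω) _
        _ = _ := by rw [integral_mul_const]; ring)

theorem Iop_apply (lam : ℝ × ℝ → ℝ) (hl : Integrable lam mu) (C : LZ) (K : BB) :
    Iop lam hl C K = ∫ ω, lam ω • K ω C ∂mu := rfl

theorem Iop_norm (lam : ℝ × ℝ → ℝ) (hl : Integrable lam mu) (C : LZ) :
    ‖Iop lam hl C‖ ≤ (∫ ω, ‖lam ω‖ ∂mu) * ‖C‖ :=
  LinearMap.mkContinuous_norm_le _ (by positivity) _

theorem ev_Iop {σ : ℝ} {K : BB} {t : ℝ × ℝ → ℝ} (h : IsMul σ K t)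
    (lam : ℝ × ℝ → ℝ) (hl : Integrable lam mu) (C : LZ) (r : ℝ) (hC : ev σ C = r) :
    ev σ (Iop lam hl C K) = ((∫ ω, lam ω * t ω * r ∂mu : ℝ) : ℂ) := by
  rw [Iop_apply, ← (ev σ).integral_comp_comm (Iop_int hl C K), ← integral_complex_ofReal]
  congr 1; ext1 ω
  rw [map_smul, h ω C, hC]; simp [mul_assoc]

theorem IsMul.meas {σ : ℝ} {K : BB} {t : ℝ × ℝ → ℝ} (h : IsMul σ K t) : Continuous t := by
  have h1 : t = fun ω => (ev σ (K ω e0)).re := by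
    ext1 ω; rw [h ω e0, ev_e0]; simp
  rw [h1]
  have hc : Continuous fun ω => K ω e0 := K.cont_app e0
  exact Complex.continuous_re.comp ((ev σ).continuous.comp hc)

end
end DB


namespace DB
noncomputable section

/-! ### kernels -/

theorem integrable_abs {f : ℝ → ℝ} (hf : IntegrableOn f (Set.Ioi 0)) : Integrable fun x => f |x| := by
  have h1 : IntegrableOn (fun x => f |x|) (Set.Ioi 0) :=
    hf.congr_fun (fun x hx => by rw [abs_of_pos hx]) measurableSet_Ioi
  have h2 : IntegrableOn (fun x => f |x|) (Set.Iic 0) := by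
    rw [← Measure.map_neg_eq_self (volume : Measure ℝ)]
    let m : MeasurableEmbedding fun x : ℝ => -x := (Homeomorph.neg ℝ).measurableEmbedding
    rw [m.integrableOn_map_iff]
    simp_rw [Function.comp_def, abs_neg, Set.neg_preimage, Set.neg_Iic, neg_zero]
    exact Iff.mpr integrableOn_Ici_iff_integrableOn_Ioi h1
  have := h2.union h1
  rwa [Set.Iic_union_Ioi, integrableOn_univ] at this

theorem base_int {α : ℝ} (hα : α ∈ Set.Ioo (0:ℝ) 1) :
    Integrable fun τ : ℝ => min 1 (τ ^ 2) * |τ| ^ (-(2 + α)) := by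
  have h := integrable_abs (f := fun τ => min 1 (τ ^ 2) * τ ^ (-(2 + α))) (by
    rw [← Set.Ioc_union_Ioi_eq_Ioi (zero_le_one' ℝ)]
    refine IntegrableOn.union ?_ ?_
    · have h1 : IntegrableOn (fun τ : ℝ => τ ^ (-α)) (Set.Ioc 0 1) :=
        (intervalIntegrable_iff_integrableOn_Ioc_of_le zero_le_one).1
          (intervalIntegral.intervalIntegrable_rpow' (by linarith [hα.2]))
      refine h1.congr_fun (fun τ hτ => ?_) measurableSet_Ioc
      have h0 : (0:ℝ) < τ := hτ.1
      have h2 : τ ^ 2 ≤ 1 := pow_le_one₀ h0.le hτ.2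
      simp only
      rw [min_eq_right h2, ← Real.rpow_natCast, ← Real.rpow_add h0]
      congr 1; push_cast; ring
    · have h1 : IntegrableOn (fun τ : ℝ => τ ^ (-(2+α))) (Set.Ioi 1) :=
        integrableOn_Ioi_rpow_of_lt (by linarith [hα.1]) one_pos
      refine h1.congr_fun (fun τ hτ => ?_) measurableSet_Ioi
      have h2 : 1 ≤ τ ^ 2 := one_le_pow₀ (le_of_lt hτ)
      simp only
      rw [min_eq_left h2, one_mul])
  simpa using h

/-- `1 - cos` kernel -/
def gk (α τ : ℝ) : ℝ := (1 - cos τ) * |τ| ^ (-(2 + α))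

theorem one_sub_cos_le (x : ℝ) : 1 - cos x ≤ x ^ 2 / 2 := by
  linarith [Real.one_sub_sq_div_two_le_cos (x := x)]

theorem gk_nonneg (α τ : ℝ) : 0 ≤ gk α τ :=
  mul_nonneg (by linarith [cos_le_one τ]) (rpow_nonneg (abs_nonneg _) _)

theorem meas_abs_rpow (r : ℝ) : Measurable fun τ : ℝ => |τ| ^ r := by fun_prop

theorem gk_int {α : ℝ} (hα : α ∈ Set.Ioo (0:ℝ) 1) : Integrable (gk α) := by
  refine Integrable.mono' ((base_int hα).const_mul 2) ?_ (Eventually.of_forall fun τ => ?_)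
  · exact ((by fun_prop : Measurable fun τ : ℝ => 1 - cos τ).mul (meas_abs_rpow _)).aestronglyMeasurable
  · rw [Real.norm_of_nonneg (gk_nonneg _ _), gk, ← mul_assoc]
    refine mul_le_mul_of_nonneg_right ?_ (rpow_nonneg (abs_nonneg _) _)
    rcases min_cases 1 (τ ^ 2) with ⟨h, _⟩ | ⟨h, _⟩ <;> rw [h]
    · linarith [neg_one_le_cos τ]
    · linarith [one_sub_cos_le τ, sq_nonneg τ]

def C1 (α : ℝ) : ℝ := ∫ τ, gk α τ

/-- scaled kernel -/
def lamk (α : ℝ) (k : ℕ) (ω : ℝ × ℝ) : ℝ := (1 - cos (k * ω.1)) * |ω.1| ^ (-(2 + α))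

theorem lamk_eq (α : ℝ) (k : ℕ) (hk : k ≠ 0) (τ θ : ℝ) :
    lamk α k (τ, θ) = (k : ℝ) ^ (2 + α) * gk α (k * τ) := by
  have hk' : (0:ℝ) < k := by positivity
  simp only [lamk, gk, abs_mul, abs_of_pos hk']
  rw [Real.mul_rpow hk'.le (abs_nonneg _), Real.rpow_neg hk'.le]
  have : (k : ℝ) ^ (2 + α) ≠ 0 := (Real.rpow_pos_of_pos hk' _).ne'
  field_simp

theorem lamk_zero (α : ℝ) : lamk α 0 = fun _ => 0 := by
  ext ω; simp [lamk]

theorem lamk_nonneg (α : ℝ) (k : ℕ) (ω : ℝ × ℝ) : 0 ≤ lamk α k ω :=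
  mul_nonneg (by linarith [cos_le_one (k * ω.1)]) (rpow_nonneg (abs_nonneg _) _)

theorem mu_int_fst {f : ℝ → ℝ} (hf : Integrable f) : Integrable (fun ω : ℝ × ℝ => f ω.1) mu :=
  hf.comp_fst _

theorem mu_integral_fst (f : ℝ → ℝ) : ∫ ω, f ω.1 ∂mu = ∫ τ, f τ := by
  rw [mu, integral_fun_fst]; simp

theorem lamk_int {α : ℝ} (hα : α ∈ Set.Ioo (0:ℝ) 1) (k : ℕ) : Integrable (lamk α k) mu := by
  rcases Nat.eq_zero_or_pos k with h | h
  · subst h; rw [lamk_zero]; exact integrable_zero _ _ _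
  · have : lamk α k = fun ω => (fun τ => (k : ℝ) ^ (2 + α) * gk α (k * τ)) ω.1 := by
      ext ⟨τ, θ⟩; exact lamk_eq α k h.ne' τ θ
    rw [this]
    exact mu_int_fst (((gk_int hα).comp_mul_left' (by positivity)).const_mul _)

theorem lamk_integral {α : ℝ} (hα : α ∈ Set.Ioo (0:ℝ) 1) (k : ℕ) :
    ∫ ω, lamk α k ω ∂mu = C1 α * (k : ℝ) ^ (1 + α) := by
  rcases Nat.eq_zero_or_pos k with h | h
  · subst h; rw [lamk_zero]; simp [Real.zero_rpow (by linarith [hα.1] : 1 + α ≠ 0)]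
  · have hk' : (0:ℝ) < k := by positivity
    have : lamk α k = fun ω => (fun τ => (k : ℝ) ^ (2 + α) * gk α (k * τ)) ω.1 := by
      ext ⟨τ, θ⟩; exact lamk_eq α k h.ne' τ θ
    rw [this, mu_integral_fst, integral_const_mul, Measure.integral_comp_mul_left,
      abs_of_pos (inv_pos.2 hk'), C1, show 2 + α = (1 + α) + 1 by ring, Real.rpow_add hk', Real.rpow_one,
      smul_eq_mul]
    field_simp

/-- exponent -/
abbrev ex (α : ℝ) : ℝ := -(2 + α) / 2

def p0 (α x : ℝ) (τ : ℝ) : ℝ := (τ ^ 2 + x ^ 2) ^ ex α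

theorem p0_nonneg (α x τ : ℝ) : 0 ≤ p0 α x τ := by unfold p0; positivity
theorem p0_pos (α : ℝ) {x : ℝ} (hx : 0 < x) (τ : ℝ) : 0 < p0 α x τ := by unfold p0; positivity

theorem f_int {α : ℝ} (hα : α ∈ Set.Ioo (0:ℝ) 1) : Integrable fun τ : ℝ => (1 + τ ^ 2) ^ ex α := by
  have := integrable_rpow_neg_one_add_norm_sq (E := ℝ) (μ := volume) (r := 2 + α) (by simp; linarith [hα.1])
  simp only [Real.norm_eq_abs, sq_abs] at this
  exact this

theorem p0_scale (α : ℝ) {x : ℝ} (hx : 0 < x) (τ : ℝ) :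
    p0 α x τ = x ^ (-(2 + α)) * (1 + (τ / x) ^ 2) ^ ex α := by
  have : τ ^ 2 + x ^ 2 = x ^ 2 * (1 + (τ / x) ^ 2) := by field_simp; ring
  rw [p0, this, Real.mul_rpow (by positivity) (by positivity), ← Real.rpow_natCast, ← Real.rpow_mul hx.le]
  congr 2; simp [ex]; ring

theorem p0_int {α : ℝ} (hα : α ∈ Set.Ioo (0:ℝ) 1) {x : ℝ} (hx : 0 < x) : Integrable (p0 α x) := by
  have := ((f_int hα).comp_div hx.ne').const_mul (x ^ (-(2 + α)))
  refine this.congr (Eventually.of_forall fun τ => ?_)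
  exact (p0_scale α hx τ).symm

theorem p0_cont (α : ℝ) {x : ℝ} (hx : 0 < x) : Continuous (p0 α x) := by
  unfold p0
  refine Continuous.rpow_const (by fun_prop) fun τ => Or.inl (by positivity)

end
end DB


namespace DB
noncomputable section

/-! ### the operators -/

def nk (α : ℝ) (k : ℕ) : ℝ := 1 + (k : ℝ) ^ (1 + α)

theorem nk_one_le (α : ℝ) (k : ℕ) : 1 ≤ nk α k := by
  unfold nk; linarith [Real.rpow_nonneg (Nat.cast_nonneg (α := ℝ) k) (1 + α)]
theorem nk_pos (α : ℝ) (k : ℕ) : 0 < nk α k := lt_of_lt_of_le one_pos (nk_one_le α k)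
theorem nk_ge {α : ℝ} (hα : 0 < α) (k : ℕ) : (k : ℝ) ≤ nk α k := by
  rcases Nat.eq_zero_or_pos k with h | h
  · subst h; simpa using (nk_pos α 0).le
  · have h1 : (1:ℝ) ≤ k := by exact_mod_cast h
    have := Real.rpow_le_rpow_of_exponent_le h1 (by linarith : (1:ℝ) ≤ 1 + α)
    rw [Real.rpow_one] at this
    unfold nk; linarith

/-- basis weights -/
def wk (α : ℝ) (k : ℕ) : ℝ := (2 ^ k * nk α k)⁻¹
theorem wk_pos (α : ℝ) (k : ℕ) : 0 < wk α k := by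
  have := nk_pos α k
  unfold wk; positivity
theorem wk_mul (α : ℝ) (k : ℕ) : wk α k * 2 ^ k = (nk α k)⁻¹ := by
  have := nk_pos α k
  unfold wk; field_simp
theorem wk_le (α : ℝ) (k : ℕ) : wk α k ≤ 1 :=
  inv_le_one_of_one_le₀ (one_le_mul_of_one_le_of_one_le (one_le_pow₀ (by norm_num)) (nk_one_le α k))

/-- norm bound helper -/
theorem wk_smul_norm (α : ℝ) (k : ℕ) {W : Type*} [NormedAddCommGroup W] [NormedSpace ℝ W] (X : W) {B : ℝ}
    (hX : ‖X‖ ≤ 2 ^ k * (B * nk α k)) : ‖wk α k • X‖ ≤ B := by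
  have h := nk_pos α k
  rw [norm_smul, Real.norm_of_nonneg (wk_pos α k).le]
  calc wk α k * ‖X‖ ≤ wk α k * (2 ^ k * (B * nk α k)) := by
        gcongr; exact (wk_pos α k).le
    _ = B := by rw [← mul_assoc, wk_mul]; field_simp

/-- the function with coefficient vector `c` -/
def phi (α σ : ℝ) : V →L[ℝ] ℝ := rlift (fun k => wk α k * cos (k * σ)) 1 (fun k => by
  rw [norm_mul, Real.norm_of_nonneg (wk_pos α k).le]
  exact mul_le_one₀ (wk_le α k) (norm_nonneg _) (abs_cos_le_one _))

theorem phi_hasSum (α σ : ℝ) (c : V) : HasSum (fun k => c k * (wk α k * cos (k * σ))) (phi α σ c) := by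
  exact rlift_hasSum (fun k => wk α k * cos (k * σ)) 1 _ c

theorem phi_single (α σ : ℝ) (k : ℕ) (x : ℝ) : phi α σ (lp.single 1 k x) = x * (wk α k * cos (k * σ)) := by
  rw [phi, rlift_single]; rfl

theorem phi_neg (α σ : ℝ) (c : V) : phi α (-σ) c = phi α σ c := by
  refine (phi_hasSum α (-σ) c).unique ?_
  simpa using phi_hasSum α σ c

theorem phi_bound (α σ : ℝ) (c : V) : |phi α σ c| ≤ ‖c‖ := by
  have := rlift_norm (fun k => wk α k * cos (k * σ)) 1 (fun k => by
    rw [norm_mul, Real.norm_of_nonneg (wk_pos α k).le]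
    exact mul_le_one₀ (wk_le α k) (norm_nonneg _) (abs_cos_le_one _)) c
  rwa [one_mul] at this

theorem IsMul.rlift {σ : ℝ} {b : ℕ → BB} {C : ℝ} {h : ∀ k, ‖b k‖ ≤ C} {t : ℕ → ℝ × ℝ → ℝ}
    (hb : ∀ k, IsMul σ (b k) (t k)) (c : V) :
    IsMul σ (DB.rlift b C h c) (fun ω => ∑' k, c k * t k ω) := by
  intro ω y
  have h2 := ((ev σ).comp ((ContinuousLinearMap.apply ℝ LZ y).comp (evalBB ω))).hasSum (rlift_hasSum b C h c)
  have h3 : Summable fun k => c k * t k ω := by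
    refine Summable.of_norm_bounded ((l1_summable c).mul_right C) fun k => ?_
    rw [norm_mul]
    gcongr
    exact ((hb k).bound ω).trans (h k)
  have h4 := (Complex.hasSum_ofReal.2 h3.hasSum).mul_right (ev σ y)
  refine h2.unique (h4.congr_fun fun k => ?_)
  have h5 := hb k ω y
  simp only [map_smul, ContinuousLinearMap.comp_apply, ContinuousLinearMap.apply_apply]
  rw [evalBB_apply, h5]
  simp [mul_assoc]

theorem IsMul.congr {σ : ℝ} {K : BB} {s t : ℝ × ℝ → ℝ} (h : IsMul σ K s) (hst : ∀ ω, s ω = t ω) :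
    IsMul σ K t := by
  have : s = t := funext hst
  rwa [← this]

/-! #### S -/

theorem ek_cont (k : ℤ) : Continuous (ek k) := by unfold ek; fun_prop

def Sz (k : ℕ) (ω : ℝ × ℝ) : ℂ := 1 + ek (-k) ω.1
theorem Sz_cont (k : ℕ) : Continuous (Sz k) := by
  unfold Sz; exact continuous_const.add ((ek_cont _).comp continuous_fst)
theorem Sz_norm (k : ℕ) (ω : ℝ × ℝ) : ‖Sz k ω‖ ≤ 2 := by
  refine (norm_add_le _ _).trans ?_
  rw [ek_norm]; norm_num

def mkW (k : ℕ) (z : ℝ × ℝ → ℂ) (hz : Continuous z) (B : ℝ) (hB : ∀ ω, ‖z ω‖ ≤ B) : BB :=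
  mkBB (fun ω => Wk k (z ω)) ((Wk k).continuous.comp hz) (2 ^ k * B) (fun ω => (Wk_norm k _).trans
    (mul_le_mul_of_nonneg_left (hB ω) (by positivity)))

theorem mkW_norm (k : ℕ) (z : ℝ × ℝ → ℂ) (hz : Continuous z) (B : ℝ) (hB : ∀ ω, ‖z ω‖ ≤ B) :
    ‖mkW k z hz B hB‖ ≤ 2 ^ k * B := mkBB_norm _ _ _ _

theorem mkW_isMul (σ : ℝ) (k : ℕ) (z : ℝ × ℝ → ℂ) (hz : Continuous z) (B : ℝ) (hB : ∀ ω, ‖z ω‖ ≤ B) :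
    IsMul σ (mkW k z hz B hB) (fun ω => (z ω * ek k σ).re) := fun ω y => by
  rw [mkW, mkBB_at, ev_W]

def Sb (α : ℝ) (k : ℕ) : BB := wk α k • mkW k (Sz k) (Sz_cont k) 2 (Sz_norm k)
theorem Sb_norm (α : ℝ) (k : ℕ) : ‖Sb α k‖ ≤ 2 := by
  refine wk_smul_norm α k _ ((mkW_norm _ _ _ _ _).trans ?_)
  gcongr; linarith [nk_one_le α k]

def Sop (α : ℝ) : V →L[ℝ] BB := rlift (Sb α) 2 (Sb_norm α)

theorem Sz_re (k : ℕ) (ω : ℝ × ℝ) (σ : ℝ) :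
    (Sz k ω * ek k σ).re = cos (k * σ) + cos (k * (σ - ω.1)) := by
  simp only [Sz, add_mul, one_mul, Complex.add_re, Complex.mul_re, ek_re, ek_im]
  rw [mul_sub, cos_sub]
  push_cast
  rw [neg_mul, cos_neg, sin_neg]
  ring

theorem Sop_isMul (α σ : ℝ) (c : V) :
    IsMul σ (Sop α c) (fun ω => phi α σ c + phi α (σ - ω.1) c) := by
  refine (IsMul.rlift (fun k => (mkW_isMul σ k (Sz k) _ _ _).smul (wk α k)) c).congr fun ω => ?_
  refine HasSum.tsum_eq ?_
  refine ((phi_hasSum α σ c).add (phi_hasSum α (σ - ω.1) c)).congr_fun fun k => ?_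
  rw [Sz_re]; ring

/-! #### Q -/

def epz (k : ℕ) (τ : ℝ) : ℂ := Complex.I * k * Complex.exp (((-(k * τ / 2) : ℝ) : ℂ) * Complex.I) * (sinc (k * τ / 2) : ℝ)

theorem epz_cont (k : ℕ) : Continuous (epz k) := by
  unfold epz
  have : Continuous fun τ : ℝ => sinc (k * τ / 2) := Real.continuous_sinc.comp (by fun_prop)
  fun_prop

theorem epz_norm (k : ℕ) (τ : ℝ) : ‖epz k τ‖ ≤ k := by
  simp only [epz, norm_mul, Complex.norm_I, Complex.norm_exp_ofReal_mul_I, Complex.norm_real,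
    Complex.norm_natCast, one_mul, mul_one, Real.norm_eq_abs]
  exact mul_le_of_le_one_right (Nat.cast_nonneg k) (Real.abs_sinc_le_one _)

theorem epz_re (k : ℕ) {τ : ℝ} (hτ : τ ≠ 0) (σ : ℝ) :
    (epz k τ * ek k σ).re = (cos (k * σ) - cos (k * (σ - τ))) / τ := by
  rcases Nat.eq_zero_or_pos k with h | h
  · subst h; simp [epz]
  have hk : (k : ℝ) ≠ 0 := by positivity
  have hs : sinc (k * τ / 2) = sin (k * τ / 2) / (k * τ / 2) := Real.sinc_of_ne_zero (by positivity)
  have e1 : epz k τ * ek k σ = ((k * sinc (k * τ / 2) : ℝ) : ℂ) *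
      (Complex.I * Complex.exp (((k * σ - k * τ / 2 : ℝ) : ℂ) * Complex.I)) := by
    have : Complex.exp (((k * σ - k * τ / 2 : ℝ) : ℂ) * Complex.I) =
      Complex.exp (((-(k * τ / 2) : ℝ) : ℂ) * Complex.I) * ek k σ := by
      rw [ek, ← Complex.exp_add]; congr 1; push_cast; ring
    rw [this, epz]; push_cast; ring
  rw [e1, Complex.re_ofReal_mul, Complex.mul_re, Complex.exp_ofReal_mul_I_im, Complex.exp_ofReal_mul_I_re,
    Complex.I_re, Complex.I_im, hs, cos_sub_cos]
  rw [show (k * σ + k * (σ - τ)) / 2 = k * σ - k * τ / 2 by ring,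
    show (k * σ - k * (σ - τ)) / 2 = k * τ / 2 by ring]
  field_simp
  ring

def clamp (θ : ℝ) : ℝ := max 0 (min 1 θ)
theorem clamp_cont : Continuous clamp := by unfold clamp; fun_prop
theorem clamp_nonneg (θ : ℝ) : 0 ≤ clamp θ := le_max_left _ _
theorem clamp_le (θ : ℝ) : clamp θ ≤ 1 := max_le zero_le_one (min_le_left _ _)
theorem clamp_eq {θ : ℝ} (h : θ ∈ Set.Icc (0:ℝ) 1) : clamp θ = θ := by
  rw [clamp, min_eq_right h.2, max_eq_right h.1]

def Qz (k : ℕ) (ω : ℝ × ℝ) : ℂ := (clamp ω.2 : ℂ) * epz k ω.1 + ((1 - clamp ω.2 : ℝ) : ℂ) * epz k (-ω.1)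
theorem Qz_cont (k : ℕ) : Continuous (Qz k) := by
  have h1 := epz_cont k
  have h2 := clamp_cont
  unfold Qz
  fun_prop
theorem Qz_norm (k : ℕ) (ω : ℝ × ℝ) : ‖Qz k ω‖ ≤ k := by
  refine (norm_add_le _ _).trans ?_
  rw [norm_mul, norm_mul, Complex.norm_real, Complex.norm_real, Real.norm_of_nonneg (clamp_nonneg _),
    Real.norm_of_nonneg (by linarith [clamp_le ω.2])]
  nlinarith [mul_le_mul_of_nonneg_left (epz_norm k ω.1) (clamp_nonneg ω.2),
    mul_le_mul_of_nonneg_left (epz_norm k (-ω.1)) (by linarith [clamp_le ω.2] : 0 ≤ 1 - clamp ω.2)]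

def Qb (α : ℝ) (k : ℕ) : BB := wk α k • mkW k (Qz k) (Qz_cont k) k (Qz_norm k)
theorem Qb_norm {α : ℝ} (hα : 0 < α) (k : ℕ) : ‖Qb α k‖ ≤ 1 := by
  refine wk_smul_norm α k _ ((mkW_norm _ _ _ _ _).trans ?_)
  gcongr; linarith [nk_ge hα k]

def Qop (α : ℝ) (hα : 0 < α) : V →L[ℝ] BB := rlift (Qb α) 1 (Qb_norm hα)

theorem Qop_isMul {α : ℝ} (hα : 0 < α) (σ : ℝ) (c : V) :
    ∃ t, IsMul σ (Qop α hα c) t ∧ ∀ τ θ : ℝ, τ ≠ 0 → θ ∈ Set.Icc (0:ℝ) 1 →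
      t (τ, θ) = θ * ((phi α σ c - phi α (σ - τ) c) / τ)
        + (1 - θ) * ((phi α σ c - phi α (σ + τ) c) / (-τ)) := by
  refine ⟨_, IsMul.rlift (fun k => (mkW_isMul σ k (Qz k) _ _ _).smul (wk α k)) c, ?_⟩
  intro τ θ hτ hθ
  refine HasSum.tsum_eq ?_
  have h1 := (((phi_hasSum α σ c).sub (phi_hasSum α (σ - τ) c)).div_const τ).mul_left θ
  have h2 := (((phi_hasSum α σ c).sub (phi_hasSum α (σ + τ) c)).div_const (-τ)).mul_left (1 - θ)
  refine (h1.add h2).congr_fun fun k => ?_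
  simp only [Qz, add_mul, Complex.add_re, mul_assoc, Complex.re_ofReal_mul, clamp_eq hθ]
  rw [epz_re k hτ, epz_re k (neg_ne_zero.2 hτ)]
  simp only [sub_neg_eq_add]
  ring

/-! #### Theta and kappa -/

def Theta : BB := mkBB (fun ω => clamp ω.2 • (1 : A)) (by have := clamp_cont; fun_prop) 1 (fun ω => by
  rw [norm_smul, Real.norm_of_nonneg (clamp_nonneg _)]
  exact mul_le_one₀ (clamp_le _) (norm_nonneg _) ContinuousLinearMap.norm_id_le)

theorem Theta_isMul (σ : ℝ) : IsMul σ Theta (fun ω => clamp ω.2) := fun ω y => by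
  simp [Theta]

def kap (x : ℝ) (hx : 0 < x) : BB := mkBB (fun ω => (ω.1 ^ 2 + x ^ 2)⁻¹ • (1 : A))
  (by
    have : Continuous fun ω : ℝ × ℝ => (ω.1 ^ 2 + x ^ 2)⁻¹ :=
      Continuous.inv₀ (by fun_prop) (fun ω => by positivity)
    fun_prop) ((x ^ 2)⁻¹) (fun ω => by
  rw [norm_smul, Real.norm_of_nonneg (by positivity)]
  refine (mul_le_of_le_one_right (by positivity) ContinuousLinearMap.norm_id_le).trans ?_
  gcongr
  linarith [sq_nonneg ω.1])

theorem kap_isMul (x : ℝ) (hx : 0 < x) (σ : ℝ) : IsMul σ (kap x hx) (fun ω => (ω.1 ^ 2 + x ^ 2)⁻¹) := fun ω y => by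
  simp [kap]

/-! #### J -/

def Ck (k : ℕ) : LZ := (1 / 2 * 2 ^ k : ℝ) • (lp.single 1 (k : ℤ) (1 : ℂ) + lp.single 1 (-k : ℤ) (1 : ℂ))

theorem Ck_norm (k : ℕ) : ‖Ck k‖ ≤ 2 ^ k := by
  rw [Ck, norm_smul, Real.norm_of_nonneg (by positivity)]
  have h1 : ‖(lp.single 1 (k : ℤ) (1 : ℂ) : LZ)‖ = 1 := by rw [single_norm (E := ℂ)]; simp
  have h2 : ‖(lp.single 1 (-k : ℤ) (1 : ℂ) : LZ)‖ = 1 := by rw [single_norm (E := ℂ)]; simp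
  have := norm_add_le (lp.single 1 (k : ℤ) (1 : ℂ) : LZ) (lp.single 1 (-k : ℤ) (1 : ℂ))
  rw [h1, h2] at this
  calc _ ≤ (1 / 2 * 2 ^ k : ℝ) * (1 + 1) := by gcongr
    _ = _ := by ring

theorem ev_Ck (k : ℕ) (σ : ℝ) : ev σ (Ck k) = (cos (k * σ) : ℝ) := by
  have h1 : ek k σ + ek (-k) σ = ((2 * cos (k * σ) : ℝ) : ℂ) := by
    rw [ek_conj, Complex.add_conj, ek_re]; push_cast; rfl
  rw [Ck, map_smul, map_add, ev_single, ev_single, wt_neg, wt_nat, mul_one, mul_one, ← add_mul, h1,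
    Complex.real_smul]
  push_cast
  field_simp

theorem Pi0_Ck (k : ℕ) : Pi0 (Ck k) = lp.single 1 k (2 ^ k) := by
  rw [Ck, map_smul, map_add, Pi0_single, Pi0_single, Int.natAbs_neg, Int.natAbs_natCast, ← lp.single_add,
    ← lp.single_smul]
  congr 1
  simp; ring

def Jb {α : ℝ} (hα : α ∈ Set.Ioo (0:ℝ) 1) (k : ℕ) : BB →L[ℝ] LZ :=
  wk α k • Iop (lamk α k) (lamk_int hα k) (Ck k)

theorem C1_nonneg (α : ℝ) : 0 ≤ C1 α := integral_nonneg (gk_nonneg α)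

theorem lamk_norm_integral {α : ℝ} (hα : α ∈ Set.Ioo (0:ℝ) 1) (k : ℕ) :
    ∫ ω, ‖lamk α k ω‖ ∂mu ≤ C1 α * nk α k := by
  simp_rw [Real.norm_of_nonneg (lamk_nonneg α k _)]
  rw [lamk_integral hα k]
  refine mul_le_mul_of_nonneg_left ?_ (C1_nonneg α)
  unfold nk; linarith

theorem Jb_norm {α : ℝ} (hα : α ∈ Set.Ioo (0:ℝ) 1) (k : ℕ) : ‖Jb hα k‖ ≤ C1 α := by
  refine wk_smul_norm α k _ ((Iop_norm _ _ _).trans ?_)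
  rw [mul_comm (2 ^ k)]
  have h1 := C1_nonneg α
  have h2 := nk_pos α k
  gcongr
  · exact lamk_norm_integral hα k
  · exact Ck_norm k

def Jop {α : ℝ} (hα : α ∈ Set.Ioo (0:ℝ) 1) : V →L[ℝ] (BB →L[ℝ] LZ) := rlift (Jb hα) (C1 α) (Jb_norm hα)

end
end DB


namespace DB
noncomputable section

def dl (φ : ℝ → ℝ) (σ τ : ℝ) : ℝ := φ σ - (φ (σ - τ) + φ (σ + τ)) / 2
def rr (φ : ℝ → ℝ) (σ τ θ : ℝ) : ℝ :=
  θ * ((φ σ - φ (σ - τ)) / τ) + (1 - θ) * ((φ σ - φ (σ + τ)) / (-τ))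
def ss (φ : ℝ → ℝ) (σ τ : ℝ) : ℝ := φ σ + φ (σ - τ)

def e1 (α a : ℝ) (φ : ℝ → ℝ) (σ : ℝ) (ω : ℝ × ℝ) : ℝ :=
  dl φ σ ω.1 * |ω.1| ^ (-(2 + α)) * (1 + a ^ 2 * (rr φ σ ω.1 ω.2) ^ 2) ^ ex α
def e2 (α x a : ℝ) (φ : ℝ → ℝ) (σ : ℝ) (ω : ℝ × ℝ) : ℝ :=
  ss φ σ ω.1 * (ω.1 ^ 2 + (x + ω.2 * a * ss φ σ ω.1) ^ 2) ^ ex α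

theorem mu_neg (f : ℝ × ℝ → ℝ) : ∫ ω, f (-ω.1, ω.2) ∂mu = ∫ ω, f ω ∂mu := by
  have h : MeasurePreserving ((MeasurableEquiv.neg ℝ).prodCongr (MeasurableEquiv.refl ℝ)) mu mu :=
    (Measure.measurePreserving_neg volume).prod (MeasurePreserving.id _)
  exact h.integral_comp' (g := f)

theorem e1_even (α a : ℝ) {φ : ℝ → ℝ} (hφ : ∀ s, φ (-s) = φ s) (σ : ℝ) :
    ∫ ω, e1 α a φ (-σ) ω ∂mu = ∫ ω, e1 α a φ σ ω ∂mu := by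
  rw [← mu_neg (e1 α a φ σ)]
  congr 1; ext1 ω
  have h1 : φ (-σ - ω.1) = φ (σ + ω.1) := by rw [← hφ]; congr 1; ring
  have h2 : φ (-σ + ω.1) = φ (σ - ω.1) := by rw [← hφ]; congr 1; ring
  simp only [e1, dl, rr, h1, h2, hφ, abs_neg, sub_neg_eq_add, neg_neg, ← sub_eq_add_neg]
  rw [add_comm (φ (σ + ω.1))]
  congr 4
  rw [div_neg, div_neg]
  ring

theorem e2_even (α x a : ℝ) {φ : ℝ → ℝ} (hφ : ∀ s, φ (-s) = φ s) (σ : ℝ) :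
    ∫ ω, e2 α x a φ (-σ) ω ∂mu = ∫ ω, e2 α x a φ σ ω ∂mu := by
  rw [← mu_neg (e2 α x a φ σ)]
  congr 1; ext1 ω
  have h1 : φ (-σ - ω.1) = φ (σ + ω.1) := by rw [← hφ]; congr 1; ring
  simp only [e2, ss, h1, hφ, sub_neg_eq_add, neg_sq]

theorem mu_ae : ∀ᵐ ω ∂mu, ω.1 ≠ 0 ∧ ω.2 ∈ Set.Icc (0:ℝ) 1 := by
  have h1 : ∀ᵐ τ : ℝ, τ ≠ 0 := by
    simp [ae_iff]
  have h2 : ∀ᵐ θ ∂((volume : Measure ℝ).restrict (Set.Icc 0 1)), θ ∈ Set.Icc (0:ℝ) 1 :=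
    ae_restrict_mem measurableSet_Icc
  have h3 := (Measure.quasiMeasurePreserving_fst (μ := (volume : Measure ℝ))
    (ν := (volume : Measure ℝ).restrict (Set.Icc 0 1))).ae h1
  have h4 := (Measure.quasiMeasurePreserving_snd (μ := (volume : Measure ℝ))
    (ν := (volume : Measure ℝ).restrict (Set.Icc 0 1))).ae h2
  filter_upwards [h3, h4] with ω a b using ⟨a, b⟩

theorem phi_cont (α : ℝ) (c : V) : Continuous fun s => phi α s c := by
  have h := (Sop_isMul α 0 c).meas
  have h1 : Continuous fun s : ℝ => ((s, 0) : ℝ × ℝ) := by fun_prop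
  have h2 := (h.comp h1).sub (continuous_const (y := phi α 0 c))
  refine h2.congr fun s => ?_
  simp [phi_neg]

theorem dl_hasSum (α σ τ : ℝ) (c : V) :
    HasSum (fun k => c k * (wk α k * (cos (k * σ) * (1 - cos (k * τ))))) (dl (fun s => phi α s c) σ τ) := by
  have h := (phi_hasSum α σ c).sub (((phi_hasSum α (σ - τ) c).add (phi_hasSum α (σ + τ) c)).div_const 2)
  refine h.congr_fun fun k => ?_
  rw [mul_sub (k : ℝ), mul_add (k : ℝ), cos_sub, cos_add]
  ring

theorem sq_le_two_pow (k : ℕ) : (k : ℝ) ^ 2 ≤ 2 * 2 ^ k := by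
  have h : ∀ k : ℕ, k ^ 2 ≤ 2 * 2 ^ k := by
    intro k
    induction k using Nat.strong_induction_on with
    | _ k ih =>
      rcases Nat.lt_or_ge k 4 with h | h
      · interval_cases k <;> norm_num
      · obtain ⟨m, rfl⟩ : ∃ m, k = m + 1 := ⟨k - 1, by omega⟩
        have := ih m (by omega)
        rw [pow_succ 2 m]
        nlinarith
  exact_mod_cast h k

theorem wk_sq (α : ℝ) (k : ℕ) : wk α k * (k : ℝ) ^ 2 ≤ 2 := by
  have h := nk_one_le α k
  have h2 := sq_le_two_pow k
  rw [wk, inv_mul_le_iff₀ (by positivity)]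
  have : (0:ℝ) < 2 ^ k := by positivity
  nlinarith

theorem wk_cos (α : ℝ) (k : ℕ) (τ : ℝ) : wk α k * (1 - cos (k * τ)) ≤ 2 * min 1 (τ ^ 2) := by
  have h1 := wk_le α k
  have h0 := (wk_pos α k).le
  have h2 : 0 ≤ 1 - cos (k * τ) := by linarith [cos_le_one (k * τ)]
  rcases min_cases 1 (τ ^ 2) with ⟨h, _⟩ | ⟨h, _⟩ <;> rw [h]
  · nlinarith [neg_one_le_cos (k * τ)]
  · have h3 := one_sub_cos_le (k * τ)
    calc _ ≤ wk α k * ((k * τ) ^ 2 / 2) := by gcongr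
      _ = (wk α k * (k : ℝ) ^ 2) * (τ ^ 2 / 2) := by ring
      _ ≤ 2 * (τ ^ 2 / 2) := by gcongr; exact wk_sq α k
      _ ≤ _ := by nlinarith [sq_nonneg τ]

theorem dl_bound (α σ τ : ℝ) (c : V) :
    |dl (fun s => phi α s c) σ τ| ≤ 2 * ‖c‖ * min 1 (τ ^ 2) := by
  rw [← Real.norm_eq_abs, ← (dl_hasSum α σ τ c).tsum_eq]
  have hs := (l1_summable c).hasSum.mul_left (2 * min 1 (τ ^ 2))
  rw [← l1_norm] at hs
  refine (tsum_of_norm_bounded hs fun k => ?_).trans (le_of_eq (by ring))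
  have h2 : 0 ≤ 1 - cos (k * τ) := by linarith [cos_le_one (k * τ)]
  rw [norm_mul, norm_mul, norm_mul, Real.norm_of_nonneg (wk_pos α k).le, Real.norm_of_nonneg h2]
  calc _ = ‖c k‖ * (‖cos (k * σ)‖ * (wk α k * (1 - cos (k * τ)))) := by ring
    _ ≤ ‖c k‖ * (1 * (2 * min 1 (τ ^ 2))) := by
      have := wk_pos α k
      refine mul_le_mul_of_nonneg_left ?_ (norm_nonneg _)
      exact mul_le_mul (abs_cos_le_one _) (wk_cos α k τ) (mul_nonneg this.le h2) zero_le_one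
    _ = _ := by ring

theorem dl_int {α : ℝ} (hα : α ∈ Set.Ioo (0:ℝ) 1) (σ : ℝ) (c : V) :
    Integrable fun τ => dl (fun s => phi α s c) σ τ * |τ| ^ (-(2 + α)) := by
  have h := phi_cont α c
  have hm : Continuous fun τ => dl (fun s => phi α s c) σ τ := by unfold dl; fun_prop
  refine Integrable.mono' ((base_int hα).const_mul (2 * ‖c‖))
    ((hm.measurable.mul (meas_abs_rpow _)).aestronglyMeasurable) (Eventually.of_forall fun τ => ?_)
  rw [norm_mul, Real.norm_of_nonneg (rpow_nonneg (abs_nonneg τ) _), ← mul_assoc]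
  exact mul_le_mul_of_nonneg_right (dl_bound α σ τ c) (rpow_nonneg (abs_nonneg τ) _)

theorem IsMul.integrable {σ : ℝ} {K : BB} {t : ℝ × ℝ → ℝ} (h : IsMul σ K t) {lam : ℝ × ℝ → ℝ}
    (hl : Integrable lam mu) : Integrable (fun ω => lam ω * t ω) mu :=
  hl.mul_bdd (c := ‖K‖) h.meas.aestronglyMeasurable (Eventually.of_forall h.bound)

theorem ev_Jop {α : ℝ} (hα : α ∈ Set.Ioo (0:ℝ) 1) {σ : ℝ} {K : BB} {t : ℝ × ℝ → ℝ} (h : IsMul σ K t) (c : V) :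
    ev σ (Jop hα c K) =
      ((∫ ω, dl (fun s => phi α s c) σ ω.1 * |ω.1| ^ (-(2 + α)) * t ω ∂mu : ℝ) : ℂ) := by
  let T : (BB →L[ℝ] LZ) →L[ℝ] ℂ := (ev σ).comp (ContinuousLinearMap.apply ℝ LZ K)
  have h1 := T.hasSum (rlift_hasSum (Jb hα) (C1 α) (Jb_norm hα) c)
  have hF : ∀ k : ℕ, Integrable (fun ω => (c k * wk α k) * (lamk α k ω * t ω * cos (k * σ))) mu := fun k =>
    ((h.integrable (lamk_int hα k)).mul_const _).const_mul _
  have hS : Summable fun k : ℕ => ∫ ω, ‖(c k * wk α k) * (lamk α k ω * t ω * cos (k * σ))‖ ∂mu := by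
    refine Summable.of_nonneg_of_le (fun k => integral_nonneg fun ω => norm_nonneg _) (fun k => ?_)
      ((l1_summable c).mul_right (C1 α * ‖K‖))
    have hw := wk_pos α k
    calc _ ≤ ∫ ω, ‖c k‖ * wk α k * ‖K‖ * ‖lamk α k ω‖ ∂mu := by
          refine integral_mono (hF k).norm ((lamk_int hα k).norm.const_mul _) fun ω => ?_
          simp only [norm_mul, Real.norm_of_nonneg hw.le]
          calc ‖c k‖ * wk α k * (‖lamk α k ω‖ * ‖t ω‖ * ‖cos (k * σ)‖)
              ≤ ‖c k‖ * wk α k * (‖lamk α k ω‖ * ‖K‖ * 1) := by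
                gcongr
                · exact h.bound ω
                · exact abs_cos_le_one _
            _ = _ := by ring
      _ = ‖c k‖ * wk α k * ‖K‖ * ∫ ω, ‖lamk α k ω‖ ∂mu := integral_const_mul _ _
      _ ≤ ‖c k‖ * wk α k * ‖K‖ * (C1 α * nk α k) := by
          gcongr; exact lamk_norm_integral hα k
      _ = ‖c k‖ * (C1 α * ‖K‖) * (wk α k * nk α k) := by ring
      _ ≤ ‖c k‖ * (C1 α * ‖K‖) * 1 := by
          have h1 := C1_nonneg α
          have h2 := nk_pos α k
          have : wk α k * nk α k ≤ 1 := by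
            rw [wk, mul_inv, mul_assoc, inv_mul_cancel₀ h2.ne', mul_one]
            exact inv_le_one_of_one_le₀ (one_le_pow₀ (by norm_num))
          gcongr
      _ = _ := mul_one _
  have h2 := hasSum_integral_of_summable_integral_norm hF hS
  have h3 : ∀ ω, ∑' k : ℕ, (c k * wk α k) * (lamk α k ω * t ω * cos (k * σ))
      = dl (fun s => phi α s c) σ ω.1 * |ω.1| ^ (-(2 + α)) * t ω := fun ω => by
    refine HasSum.tsum_eq ?_
    refine (((dl_hasSum α σ ω.1 c).mul_right (|ω.1| ^ (-(2 + α)))).mul_right (t ω)).congr_fun fun k => ?_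
    rw [lamk]; ring
  simp_rw [h3] at h2
  refine h1.unique ((Complex.hasSum_ofReal.2 h2).congr_fun fun k => ?_)
  rw [map_smul, Jb, map_smul]
  have h4 : T (Iop (lamk α k) (lamk_int hα k) (Ck k)) = ev σ (Iop (lamk α k) (lamk_int hα k) (Ck k) K) := rfl
  rw [h4, ev_Iop h _ _ _ _ (ev_Ck k σ), integral_const_mul]
  simp [mul_assoc]

/-! ### the equation -/

section eqn
variable {α : ℝ} (hα : α ∈ Set.Ioo (0:ℝ) 1) {x0 : ℝ} (hx : 0 < x0)

/-- projection killing the `cos` coefficient -/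
def coord (k : ℕ) : V →L[ℝ] ℝ := rlift (fun j => if j = k then 1 else 0) 1 (fun j => by split_ifs <;> simp)
theorem coord_single (k j : ℕ) (x : ℝ) : coord k (lp.single 1 j x) = if j = k then x else 0 := by
  rw [coord, rlift_single]; simp
def Pc : V →L[ℝ] V := ContinuousLinearMap.id ℝ V - (coord 1).smulRight (lp.single 1 1 (1:ℝ))
def b1 : V := lp.single 1 1 4

theorem phi_b1 (α σ : ℝ) : phi α σ b1 = cos σ := by
  rw [b1, phi_single, wk, nk]; simp; norm_num; ring

def yy (a δ : ℝ) (b : V) : BB := δ • 1 + a • (Theta * Sop α b)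

def K1 (a : ℝ) (b : V) : BB := a ^ 2 • (Qop α hα.1 b * Qop α hα.1 b)
def K2 (a δ : ℝ) (b : V) : BB :=
  kap x0 hx * (yy (α := α) a δ b * yy (α := α) a δ b + (2 * x0) • yy (α := α) a δ b)

theorem p0_int_mu {α : ℝ} (hα : α ∈ Set.Ioo (0:ℝ) 1) {x0 : ℝ} (hx : 0 < x0) : Integrable (fun ω : ℝ × ℝ => p0 α x0 ω.1) mu := mu_int_fst (p0_int hα hx)

def EE (a δ : ℝ) (b : V) : LZ :=
  Jop hα b (fB (ex α) (K1 hα a b)) -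
    Iop (fun ω => p0 α x0 ω.1) (p0_int_mu hα hx) e0 (Sop α b * fB (ex α) (K2 (α := α) hx a δ b))

theorem ev_EE {a δ : ℝ} {b : V} (h1 : ‖K1 hα a b‖ < 1) (h2 : ‖K2 (α := α) hx a δ b‖ < 1) (σ : ℝ) :
    ev σ (EE hα hx a δ b) = ((∫ ω, e1 α a (fun s => phi α s b) σ ω ∂mu
      - ∫ ω, e2 α (x0 + δ) a (fun s => phi α s b) σ ω ∂mu : ℝ) : ℂ)
    ∧ Integrable (e1 α a (fun s => phi α s b) σ) mu
    ∧ Integrable (e2 α (x0 + δ) a (fun s => phi α s b) σ) mu := by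
  obtain ⟨t, ht, ht'⟩ := Qop_isMul hα.1 σ b
  have i1 := ((ht.mul ht).smul (a ^ 2)).fB (e := ex α) h1
  have iS := Sop_isMul α σ b
  have iy : IsMul σ (yy (α := α) a δ b) _ := ((IsMul.one σ).smul δ).add (((Theta_isMul σ).mul iS).smul a)
  have i2 := iS.mul (((kap_isMul x0 hx σ).mul ((iy.mul iy).add (iy.smul (2 * x0)))).fB (e := ex α) h2)
  have q1 : (fun ω : ℝ × ℝ => dl (fun s => phi α s b) σ ω.1 * |ω.1| ^ (-(2 + α)) *
      (1 + a ^ 2 * (t ω * t ω)) ^ ex α) =ᵐ[mu] e1 α a (fun s => phi α s b) σ := by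
    filter_upwards [mu_ae] with ω hω
    obtain ⟨τ, θ⟩ := ω
    simp only [e1]
    rw [ht' τ θ hω.1 hω.2, ← sq]
    rfl
  have j1 := i1.integrable (mu_int_fst (dl_int hα σ b))
  have j2 := i2.integrable (p0_int_mu hα hx)
  have q2 : ∀ᵐ ω ∂mu, p0 α x0 ω.1 * ((phi α σ b + phi α (σ - ω.1) b) * (1 + (ω.1 ^ 2 + x0 ^ 2)⁻¹ *
      ((δ * 1 + a * (clamp ω.2 * (phi α σ b + phi α (σ - ω.1) b))) * (δ * 1 + a * (clamp ω.2 * (phi α σ b + phi α (σ - ω.1) b)))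
       + 2 * x0 * (δ * 1 + a * (clamp ω.2 * (phi α σ b + phi α (σ - ω.1) b))))) ^ ex α)
       = e2 α (x0 + δ) a (fun s => phi α s b) σ ω := by
    filter_upwards [mu_ae] with ω hω
    obtain ⟨τ, θ⟩ := ω
    simp only at hω ⊢
    rw [clamp_eq hω.2]
    simp only [e2, ss]
    set S := phi α σ b + phi α (σ - τ) b
    have hp : 0 < τ ^ 2 + x0 ^ 2 := by positivity
    have key : τ ^ 2 + (x0 + δ + θ * a * S) ^ 2 = (τ ^ 2 + x0 ^ 2) * (1 + (τ ^ 2 + x0 ^ 2)⁻¹ *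
      ((δ * 1 + a * (θ * S)) * (δ * 1 + a * (θ * S)) + 2 * x0 * (δ * 1 + a * (θ * S)))) := by
      field_simp; ring
    have hn : 0 ≤ (1 + (τ ^ 2 + x0 ^ 2)⁻¹ *
      ((δ * 1 + a * (θ * S)) * (δ * 1 + a * (θ * S)) + 2 * x0 * (δ * 1 + a * (θ * S)))) := by
      refine nonneg_of_mul_nonneg_right (a := τ ^ 2 + x0 ^ 2) ?_ hp
      rw [← key]; positivity
    rw [key, Real.mul_rpow hp.le hn, p0]
    ring
  refine ⟨?_, j1.congr q1, j2.congr q2⟩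
  rw [EE, map_sub, K1, K2, ev_Jop hα i1, ev_Iop i2 _ _ _ 1 (by rw [ev_e0]; simp), Complex.ofReal_sub]
  congr 2
  · exact integral_congr_ae q1
  · refine integral_congr_ae ?_
    filter_upwards [q2] with ω hω
    rw [mul_one, hω]

theorem EE_zero {a δ : ℝ} {b : V} (h1 : ‖K1 hα a b‖ < 1) (h2 : ‖K2 (α := α) hx a δ b‖ < 1)
    (h0 : Pi0 (EE hα hx a δ b) = 0) (σ : ℝ) :
    ∫ ω, e1 α a (fun s => phi α s b) σ ω ∂mu = ∫ ω, e2 α (x0 + δ) a (fun s => phi α s b) σ ω ∂mu := by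
  have h := ev_Pi0 σ (EE hα hx a δ b)
  rw [h0, map_zero, (ev_EE hα hx h1 h2 σ).1, (ev_EE hα hx h1 h2 (-σ)).1,
    e1_even α a (fun s => phi_neg α s b), e2_even α _ a (fun s => phi_neg α s b)] at h
  simp only [Complex.add_re, Complex.ofReal_re] at h
  linarith

end eqn

end
end DB


namespace DB
noncomputable section

/-! ### choice of the radius -/

theorem integral_pos' {f : ℝ → ℝ} (hf : Integrable f) (h0 : ∀ t, 0 ≤ f t) (h1 : ∀ t ∈ Set.Ioo (0:ℝ) 1, 0 < f t) :
    0 < ∫ t, f t := by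
  rw [integral_pos_iff_support_of_nonneg h0 hf]
  refine lt_of_lt_of_le ?_ (measure_mono (fun t ht => (h1 t ht).ne' : Set.Ioo (0:ℝ) 1 ⊆ Function.support f))
  simp

def I0 (α x : ℝ) : ℝ := ∫ t, p0 α x t * (1 + cos t)

theorem one_add_cos_nonneg (t : ℝ) : 0 ≤ 1 + cos t := by linarith [neg_one_le_cos t]
theorem one_add_cos_le (t : ℝ) : 1 + cos t ≤ 2 := by linarith [cos_le_one t]

theorem cos_pos01 {t : ℝ} (ht : t ∈ Set.Ioo (0:ℝ) 1) : 0 < cos t :=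
  cos_pos_of_mem_Ioo ⟨by linarith [pi_pos, ht.1], by linarith [pi_gt_three, ht.2]⟩

section
variable {α : ℝ} (hα : α ∈ Set.Ioo (0:ℝ) 1)

theorem p0cos_int (hα : α ∈ Set.Ioo (0:ℝ) 1) {x : ℝ} (hx : 0 < x) (k : ℝ) :
    Integrable fun t => p0 α x t * (1 + cos (k * t)) :=
  (p0_int hα hx).mul_bdd (c := 2) (by fun_prop) (Eventually.of_forall fun t => by
    rw [Real.norm_of_nonneg (one_add_cos_nonneg _)]; exact one_add_cos_le _)

theorem p0cos_int1 (hα : α ∈ Set.Ioo (0:ℝ) 1) {x : ℝ} (hx : 0 < x) : Integrable fun t => p0 α x t * (1 + cos t) := by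
  simpa using p0cos_int hα hx 1

theorem p0_lt (hα : α ∈ Set.Ioo (0:ℝ) 1) {x y : ℝ} (hx : 0 < x) (hxy : x < y) (t : ℝ) : p0 α y t < p0 α x t := by
  unfold p0
  refine Real.rpow_lt_rpow_of_neg (by positivity) (by gcongr) ?_
  simp only [ex]; linarith [hα.1]

theorem p0_le (hα : α ∈ Set.Ioo (0:ℝ) 1) {x y : ℝ} (hx : 0 < x) (hxy : x ≤ y) (t : ℝ) : p0 α y t ≤ p0 α x t := by
  rcases hxy.eq_or_lt with h | h
  · rw [h]
  · exact (p0_lt hα hx h t).le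

theorem I0_lt (hα : α ∈ Set.Ioo (0:ℝ) 1) {x y : ℝ} (hx : 0 < x) (hxy : x < y) : I0 α y < I0 α x := by
  have hy := hx.trans hxy
  rw [← sub_pos, I0, I0, ← integral_sub (p0cos_int1 hα hx) (p0cos_int1 hα hy)]
  refine integral_pos' ((p0cos_int1 hα hx).sub (p0cos_int1 hα hy)) (fun t => ?_) (fun t ht => ?_)
  · rw [← sub_mul]
    exact mul_nonneg (sub_nonneg.2 (p0_lt hα hx hxy t).le) (one_add_cos_nonneg t)
  · rw [← sub_mul]
    exact mul_pos (sub_pos.2 (p0_lt hα hx hxy t)) (by linarith [cos_pos01 ht])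

theorem I0_le (hα : α ∈ Set.Ioo (0:ℝ) 1) {x y : ℝ} (hx : 0 < x) (hxy : x ≤ y) : I0 α y ≤ I0 α x := by
  rcases hxy.eq_or_lt with h | h
  · rw [h]
  · exact (I0_lt hα hx h).le

theorem I0_cont (hα : α ∈ Set.Ioo (0:ℝ) 1) : ContinuousOn (I0 α) (Set.Ioi 0) := by
  intro x hx
  have hx : 0 < x := hx
  refine ContinuousAt.continuousWithinAt ?_
  refine continuousAt_of_dominated (bound := fun t => p0 α (x/2) t * (1 + cos t)) ?_ ?_ (p0cos_int1 hα (by positivity)) ?_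
  · filter_upwards [lt_mem_nhds (show 0 < x from hx)] with y hy
    exact (p0cos_int1 hα hy).1
  · filter_upwards [lt_mem_nhds (show x / 2 < x by linarith)] with y hy
    refine Eventually.of_forall fun t => ?_
    rw [Real.norm_of_nonneg (mul_nonneg (p0_nonneg _ _ _) (one_add_cos_nonneg t))]
    exact mul_le_mul_of_nonneg_right (p0_le hα (by positivity) hy.le t) (one_add_cos_nonneg t)
  · refine Eventually.of_forall fun t => ?_
    refine ContinuousAt.mul ?_ continuousAt_const
    unfold p0
    exact ContinuousAt.rpow_const (by fun_prop) (Or.inl (by positivity))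

theorem C1_pos (hα : α ∈ Set.Ioo (0:ℝ) 1) : 0 < C1 α := by
  refine integral_pos' (gk_int hα) (gk_nonneg α) fun t ht => ?_
  have h1 : cos t < 1 := by
    have := cos_lt_one_div_sqrt_sq_add_one (x := t) (by linarith [pi_pos, ht.1]) (by linarith [pi_gt_three, ht.2]) ht.1.ne'
    refine this.trans_le ?_
    rw [div_le_one (by positivity)]
    exact Real.one_le_sqrt.2 (by nlinarith [ht.1])
  exact mul_pos (by linarith) (rpow_pos_of_pos (abs_pos.2 ht.1.ne') _)

theorem p0_integral {x : ℝ} (hx : 0 < x) :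
    ∫ t, p0 α x t = x ^ (-(1 + α)) * ∫ t, (1 + t ^ 2) ^ ex α := by
  simp_rw [p0_scale α hx]
  rw [integral_const_mul, Measure.integral_comp_div (fun t : ℝ => (1 + t ^ 2) ^ ex α), abs_of_pos hx, smul_eq_mul,
    ← mul_assoc]
  congr 1
  nth_rewrite 2 [← Real.rpow_one x]
  rw [← Real.rpow_add hx]
  congr 1; ring

theorem exists_radius (hα : α ∈ Set.Ioo (0:ℝ) 1) : ∃ x, 0 < x ∧ I0 α x = C1 α := by
  have hC := C1_pos hα
  set I := ∫ t : ℝ, (1 + t ^ 2) ^ ex α with hI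
  have hI0 : 0 ≤ I := integral_nonneg fun t => by positivity
  have h2 : (0:ℝ) < 2 ^ ex α := by positivity
  set x1 := min 1 (2 ^ ex α / (C1 α + 1)) with hx1
  set x2 := max 1 (2 * I / C1 α) with hx2
  have p1 : 0 < x1 := lt_min one_pos (by positivity)
  have p2 : 1 ≤ x2 := le_max_left _ _
  have p3 : x1 ≤ 1 := min_le_left _ _
  have b2 : I0 α x2 ≤ C1 α := by
    have hp : 0 < x2 := by linarith
    calc I0 α x2 ≤ ∫ t, p0 α x2 t * 2 := by
          refine integral_mono (p0cos_int1 hα hp) ((p0_int hα hp).mul_const 2) fun t => ?_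
          exact mul_le_mul_of_nonneg_left (one_add_cos_le t) (p0_nonneg _ _ _)
      _ = x2 ^ (-(1 + α)) * (2 * I) := by rw [integral_mul_const, p0_integral hp]; ring
      _ ≤ x2 ^ (-1 : ℝ) * (2 * I) := by
          exact mul_le_mul_of_nonneg_right (Real.rpow_le_rpow_of_exponent_le p2 (by linarith [hα.1])) (by positivity)
      _ ≤ C1 α := by
          rw [Real.rpow_neg_one, inv_mul_le_iff₀ hp, ← div_le_iff₀ hC]
          exact le_max_right _ _
  have b1 : C1 α ≤ I0 α x1 := by
    have hm : ∀ t ∈ Set.Ioc (0:ℝ) x1, (2 * x1 ^ 2) ^ ex α ≤ p0 α x1 t * (1 + cos t) := by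
      intro t ht
      have h1 : (2 * x1 ^ 2) ^ ex α ≤ p0 α x1 t := by
        unfold p0
        refine Real.rpow_le_rpow_of_nonpos (by positivity) ?_ (by simp only [ex]; linarith [hα.1])
        nlinarith [ht.1, ht.2]
      have h3 : 0 ≤ cos t := cos_nonneg_of_mem_Icc ⟨by linarith [pi_pos, ht.1], by linarith [pi_gt_three, ht.2]⟩
      nlinarith [p0_nonneg α x1 t]
    have h5 : x1 * (2 * x1 ^ 2) ^ ex α ≤ I0 α x1 := by
      calc x1 * (2 * x1 ^ 2) ^ ex α = ∫ t in Set.Ioc (0:ℝ) x1, (2 * x1 ^ 2) ^ ex α := by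
            simp [p1.le]
        _ ≤ ∫ t in Set.Ioc (0:ℝ) x1, p0 α x1 t * (1 + cos t) :=
            setIntegral_mono_on (integrable_const _) (p0cos_int1 hα p1).integrableOn measurableSet_Ioc hm
        _ ≤ I0 α x1 := setIntegral_le_integral (p0cos_int1 hα p1) (Eventually.of_forall fun t =>
            mul_nonneg (p0_nonneg _ _ _) (one_add_cos_nonneg t))
    refine le_trans ?_ h5
    have h6 : x1 * (2 * x1 ^ 2) ^ ex α = 2 ^ ex α * x1 ^ (-(1 + α)) := by
      rw [Real.mul_rpow (by norm_num) (by positivity), ← Real.rpow_natCast x1 2, ← Real.rpow_mul p1.le]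
      nth_rewrite 1 [← Real.rpow_one x1]
      rw [mul_left_comm, ← Real.rpow_add p1]
      congr 2; simp [ex]; ring
    rw [h6]
    calc C1 α ≤ 2 ^ ex α * x1 ^ (-1 : ℝ) := by
          rw [Real.rpow_neg_one, ← div_eq_mul_inv, le_div_iff₀ p1]
          have : x1 ≤ 2 ^ ex α / (C1 α + 1) := min_le_right _ _
          rw [le_div_iff₀ (by positivity)] at this
          nlinarith
      _ ≤ _ := by
          gcongr 2 ^ ex α * ?_
          exact Real.rpow_le_rpow_of_exponent_ge p1 p3 (by linarith [hα.1])
  have hc : ContinuousOn (I0 α) (Set.Icc x1 x2) := (I0_cont hα).mono fun y hy => lt_of_lt_of_le p1 hy.1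
  obtain ⟨x, hx, hx'⟩ := intermediate_value_Icc' (p3.trans p2) hc ⟨b2, b1⟩
  exact ⟨x, lt_of_lt_of_le p1 hx.1, hx'⟩

theorem I0_scale (hα : α ∈ Set.Ioo (0:ℝ) 1) {x : ℝ} (hx : 0 < x) {k : ℝ} (hk : 0 < k) :
    ∫ τ, p0 α x τ * (1 + cos (k * τ)) = k ^ (1 + α) * I0 α (k * x) := by
  have h1 : ∀ τ, p0 α x τ * (1 + cos (k * τ)) = k ^ (2 + α) * (p0 α (k * x) (k * τ) * (1 + cos (k * τ))) := by
    intro τ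
    have : p0 α (k * x) (k * τ) = k ^ (-(2 + α)) * p0 α x τ := by
      unfold p0
      rw [show (k * τ) ^ 2 + (k * x) ^ 2 = k ^ 2 * (τ ^ 2 + x ^ 2) by ring,
        Real.mul_rpow (by positivity) (by positivity), ← Real.rpow_natCast k 2, ← Real.rpow_mul hk.le]
      congr 2; simp [ex]; ring
    rw [this, Real.rpow_neg hk.le]
    have : k ^ (2 + α) ≠ 0 := (Real.rpow_pos_of_pos hk _).ne'
    field_simp
  simp_rw [h1]
  rw [integral_const_mul, Measure.integral_comp_mul_left (fun t => p0 α (k * x) t * (1 + cos t)),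
    abs_of_pos (inv_pos.2 hk), I0, show 2 + α = (1 + α) + 1 by ring, Real.rpow_add hk, Real.rpow_one, smul_eq_mul]
  field_simp

end
end
end DB

namespace DB
noncomputable section

/-! ### the implicit function theorem -/

theorem single_eq (k : ℕ) (x : ℝ) : (lp.single 1 k x : V) = x • lp.single 1 k 1 := by
  rw [← lp.single_smul]; simp

theorem Pi0_Wk (k : ℕ) (z : ℂ) : Pi0 (Wk k z e0) = (2 ^ k * z.re) • (lp.single 1 k 1 : V) := by
  rw [Wk_apply, ContinuousLinearMap.smul_apply, ContinuousLinearMap.add_apply, e0, U_single, U_single, map_smul,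
    map_add, Pi0_single, Pi0_single, zero_add, zero_add, Int.natAbs_neg, Int.natAbs_natCast, wt_neg, wt_nat,
    ← lp.single_add, ← lp.single_smul, ← single_eq]
  have : wt 0 = 1 := by simp [wt]
  rw [this]
  congr 1
  have h : (((2:ℝ) ^ k / 1 : ℝ) : ℂ) = ((2 ^ k : ℝ) : ℂ) := by simp
  rw [h, mul_one, mul_one, Complex.re_mul_ofReal, Complex.re_mul_ofReal, Complex.conj_re, smul_eq_mul]
  ring

theorem Pi0_Iop_S {α : ℝ} (hα : α ∈ Set.Ioo (0:ℝ) 1) {x0 : ℝ} (hx : 0 < x0) (k : ℕ) (L : BB) (l : ℝ → ℝ)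
    (hL : ∀ ω, L ω = l ω.1 • (1 : A)) :
    Pi0 (Iop (fun ω => p0 α x0 ω.1) (p0_int_mu hα hx) e0 (Sb α k * L)) =
      ((nk α k)⁻¹ * ∫ τ, p0 α x0 τ * l τ * (1 + cos (k * τ))) • (lp.single 1 k 1 : V) := by
  rw [Iop_apply, ← Pi0.integral_comp_comm (Iop_int (p0_int_mu hα hx) _ _)]
  have h : ∀ ω : ℝ × ℝ, Pi0 (p0 α x0 ω.1 • (Sb α k * L) ω e0) =
      ((nk α k)⁻¹ * (p0 α x0 ω.1 * l ω.1 * (1 + cos (k * ω.1)))) • (lp.single 1 k 1 : V) := by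
    intro ω
    rw [BB.mul_at, hL, Sb, BB.smul_at, mkW, mkBB_at]
    simp only [ContinuousLinearMap.mul_apply, ContinuousLinearMap.smul_apply, ContinuousLinearMap.one_apply, map_smul, Pi0_Wk, smul_smul]
    congr 1
    have : (Sz k ω).re = 1 + cos (k * ω.1) := by
      have := Sz_re k ω 0
      simp [ek] at this
      simpa [cos_neg] using this
    rw [this, ← wk_mul]; ring
  simp_rw [h]
  rw [integral_smul_const, integral_const_mul, mu_integral_fst (fun τ => p0 α x0 τ * l τ * (1 + cos (k * τ)))]

theorem Iop_one (lam : ℝ × ℝ → ℝ) (hl : Integrable lam mu) (C : LZ) : Iop lam hl C 1 = (∫ ω, lam ω ∂mu) • C := by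
  rw [Iop_apply]
  simp only [BB.one_at, ContinuousLinearMap.one_apply]
  rw [integral_smul_const]

section
variable {α : ℝ} (hα : α ∈ Set.Ioo (0:ℝ) 1) {x0 : ℝ} (hx : 0 < x0)

def DL : V →L[ℝ] V := Pi0.comp (((ContinuousLinearMap.apply ℝ LZ (1:BB)).comp (Jop hα)) -
  (Iop (fun ω => p0 α x0 ω.1) (p0_int_mu hα hx) e0).comp (Sop α))

def dk (α x0 : ℝ) (k : ℕ) : ℝ := (nk α k)⁻¹ * (C1 α * (k:ℝ) ^ (1 + α) - ∫ τ, p0 α x0 τ * (1 + cos (k * τ)))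

theorem DL_single (k : ℕ) : DL hα hx (lp.single 1 k 1) = dk α x0 k • (lp.single 1 k 1 : V) := by
  rw [DL, ContinuousLinearMap.comp_apply, ContinuousLinearMap.sub_apply, ContinuousLinearMap.comp_apply,
    ContinuousLinearMap.comp_apply, Jop, rlift_single, one_smul, Sop, rlift_single, one_smul,
    ContinuousLinearMap.apply_apply, map_sub]
  have h1 := Pi0_Iop_S hα hx k 1 (fun _ => 1) (fun ω => by simp)
  rw [mul_one] at h1
  rw [h1, Jb, ContinuousLinearMap.smul_apply, Iop_one, map_smul, map_smul, Pi0_Ck, single_eq, lamk_integral hα,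
    smul_smul, smul_smul, ← sub_smul]
  congr 1
  rw [dk]
  have := wk_mul α k
  simp only [mul_one]
  linear_combination (C1 α * (k:ℝ) ^ (1 + α)) * this

def mm (α x0 : ℝ) : ℝ := 4 * ((nk α 1)⁻¹ * ∫ τ, p0 α x0 τ * (τ ^ 2 + x0 ^ 2)⁻¹ * (1 + cos τ))

theorem Pi0_kap : Pi0 (Iop (fun ω => p0 α x0 ω.1) (p0_int_mu hα hx) e0 (Sop α b1 * kap x0 hx)) =
    mm α x0 • (lp.single 1 1 1 : V) := by
  have h1 := Pi0_Iop_S hα hx 1 (kap x0 hx) (fun τ => (τ ^ 2 + x0 ^ 2)⁻¹) (fun ω => by rw [kap, mkBB_at])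
  rw [b1, Sop, rlift_single, smul_mul_assoc, map_smul, map_smul, h1, mm, smul_smul]
  simp

theorem mm_pos {α : ℝ} (hα : α ∈ Set.Ioo (0:ℝ) 1) {x0 : ℝ} (hx : 0 < x0) : 0 < mm α x0 := by
  refine mul_pos (by norm_num) (mul_pos (inv_pos.2 (nk_pos _ _)) (integral_pos' ?_ (fun t => ?_) fun t ht => ?_))
  · have := (p0cos_int1 hα hx).bdd_mul (c := (x0 ^ 2)⁻¹) (f := fun τ : ℝ => (τ ^ 2 + x0 ^ 2)⁻¹)
      (Continuous.aestronglyMeasurable (Continuous.inv₀ (by fun_prop) (fun ω => by positivity)))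
      (Eventually.of_forall fun t => by
        rw [Real.norm_of_nonneg (by positivity)]
        gcongr; linarith [sq_nonneg t])
    exact this.congr (Eventually.of_forall fun t => by simp only; ring)
  · have := p0_nonneg α x0 t
    have := one_add_cos_nonneg t
    positivity
  · have := p0_pos α hx t
    have := cos_pos01 ht
    positivity

def Dk (α x0 : ℝ) (k : ℕ) : ℝ := if k = 1 then (2 + α) * x0 * mm α x0 else dk α x0 k

theorem p0_integral_pos {α : ℝ} (hα : α ∈ Set.Ioo (0:ℝ) 1) {x0 : ℝ} (hx : 0 < x0) : 0 < ∫ τ, p0 α x0 τ :=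
  integral_pos' (p0_int hα hx) (p0_nonneg α x0) fun t _ => p0_pos α hx t

theorem Dk_bound {α : ℝ} (hα : α ∈ Set.Ioo (0:ℝ) 1) {x0 : ℝ} (hx : 0 < x0) (h0 : I0 α x0 = C1 α) : ∃ c, 0 < c ∧ ∀ k, c ≤ |Dk α x0 k| := by
  have m0 := mm_pos hα hx
  have i0 := p0_integral_pos hα hx
  have i2 : 0 < C1 α - I0 α (2 * x0) := by rw [← h0, sub_pos]; exact I0_lt hα hx (by linarith)
  have q1 : 0 < (2 + α) * x0 * mm α x0 := by have := hα.1; positivity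
  refine ⟨min ((2 + α) * x0 * mm α x0) (min (∫ τ, p0 α x0 τ) ((C1 α - I0 α (2 * x0)) / 2)), by
    refine lt_min q1 (lt_min i0 (by linarith)), fun k => ?_⟩
  unfold Dk
  split_ifs with h
  · exact (min_le_left _ _).trans (le_abs_self _)
  · refine (min_le_right _ _).trans ?_
    rcases Nat.eq_zero_or_pos k with hk | hk
    · refine (min_le_left _ _).trans ?_
      have : dk α x0 k = - (2 * ∫ τ, p0 α x0 τ) := by
        subst hk
        have h1 : 1 + α ≠ 0 := by linarith [hα.1]
        simp only [dk, nk, Nat.cast_zero, zero_mul, cos_zero, Real.zero_rpow h1]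
        rw [integral_mul_const]; ring
      rw [this, abs_neg, abs_of_pos (by linarith)]; linarith
    · refine (min_le_right _ _).trans (le_trans ?_ (le_abs_self _))
      have hk2 : (2:ℝ) ≤ k := by exact_mod_cast (by omega : 2 ≤ k)
      have hk0 : (0:ℝ) < k := by linarith
      rw [dk, I0_scale hα hx hk0]
      have h3 : I0 α (k * x0) ≤ I0 α (2 * x0) := I0_le hα (by linarith) (by gcongr)
      have h4 : 1 ≤ (k:ℝ) ^ (1 + α) := Real.one_le_rpow (by linarith) (by linarith [hα.1])
      rw [inv_mul_eq_div, le_div_iff₀ (nk_pos _ _), nk]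
      nlinarith

def Dop : V →L[ℝ] V := (DL hα hx).comp Pc - (2 * x0 * ex α) • (coord 1).smulRight (mm α x0 • (lp.single 1 1 1 : V))

theorem Pc_single (k : ℕ) : Pc (lp.single 1 k 1) = if k = 1 then 0 else lp.single 1 k 1 := by
  rw [Pc, ContinuousLinearMap.sub_apply, ContinuousLinearMap.smulRight_apply, coord_single]
  split_ifs with h
  · subst h; simp
  · simp

theorem Dop_single (k : ℕ) : Dop hα hx (lp.single 1 k 1) = Dk α x0 k • (lp.single 1 k 1 : V) := by
  rw [Dop, ContinuousLinearMap.sub_apply, ContinuousLinearMap.comp_apply, Pc_single,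
    ContinuousLinearMap.smul_apply, ContinuousLinearMap.smulRight_apply, coord_single, Dk]
  split_ifs with h
  · subst h
    rw [map_zero, zero_sub, smul_smul, smul_smul, ← neg_smul]; congr 1; unfold ex; ring
  · rw [DL_single]; simp

theorem Dop_inv {α : ℝ} (hα : α ∈ Set.Ioo (0:ℝ) 1) {x0 : ℝ} (hx : 0 < x0) (h0 : I0 α x0 = C1 α) : (Dop hα hx).IsInvertible := by
  obtain ⟨c, hc, hb⟩ := Dk_bound hα hx h0
  have hn : ∀ k, Dk α x0 k ≠ 0 := fun k => abs_pos.1 (hc.trans_le (hb k))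
  let T : V →L[ℝ] V := rlift (fun k => (Dk α x0 k)⁻¹ • (lp.single 1 k 1 : V)) c⁻¹ (fun k => by
    rw [norm_smul, norm_inv, Real.norm_eq_abs, single_norm (E := ℝ)]
    simp only [norm_one, mul_one]
    exact inv_anti₀ hc (hb k))
  have hT : ∀ k, T (lp.single 1 k 1) = (Dk α x0 k)⁻¹ • (lp.single 1 k 1 : V) := fun k => by
    simp only [T]; rw [rlift_single, one_smul]
  refine ContinuousLinearMap.IsInvertible.of_inverse (g := T) (V_ext fun k => ?_) (V_ext fun k => ?_)
  · rw [ContinuousLinearMap.comp_apply, hT, map_smul, Dop_single, smul_smul, inv_mul_cancel₀ (hn k), one_smul]; rfl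
  · rw [ContinuousLinearMap.comp_apply, Dop_single, map_smul, hT, smul_smul, mul_inv_cancel₀ (hn k), one_smul]; rfl

def GG (q : ℝ × V) : V := Pi0 (EE hα hx q.1 (coord 1 q.2) (b1 + Pc q.2))

theorem K1_cd : ContDiff ℝ 1 (fun q : ℝ × V => K1 hα q.1 (b1 + Pc q.2)) := by
  unfold K1
  have h : ContDiff ℝ 1 (fun q : ℝ × V => Qop α hα.1 (b1 + Pc q.2)) := by fun_prop
  exact (contDiff_fst.pow 2).smul (h.mul h)

theorem K2_cd : ContDiff ℝ 1 (fun q : ℝ × V => K2 (α := α) hx q.1 (coord 1 q.2) (b1 + Pc q.2)) := by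
  unfold K2
  have h : ContDiff ℝ 1 (fun q : ℝ × V => yy (α := α) q.1 (coord 1 q.2) (b1 + Pc q.2)) := by
    unfold yy
    have h1 : ContDiff ℝ 1 (fun q : ℝ × V => Sop α (b1 + Pc q.2)) := by fun_prop
    have h2 : ContDiff ℝ 1 (fun q : ℝ × V => coord 1 q.2) := by fun_prop
    exact (h2.smul contDiff_const).add (contDiff_fst.smul (contDiff_const.mul h1))
  exact contDiff_const.mul ((h.mul h).add (h.const_smul (2 * x0)))

theorem K1_zero (b : V) : K1 hα 0 b = 0 := by simp [K1]
theorem yy_zero (δ : ℝ) (b : V) : yy (α := α) 0 δ b = δ • 1 := by simp [yy]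
theorem K2_zero (δ : ℝ) (b : V) : K2 (α := α) hx 0 δ b = (δ ^ 2 + 2 * x0 * δ) • kap x0 hx := by
  rw [K2, yy_zero, smul_mul_smul_comm, mul_one, smul_smul, ← add_smul, mul_smul_comm, mul_one]
  congr 1; ring

theorem GG_cd : ContDiffAt ℝ 1 (GG hα hx) (0, 0) := by
  have h1 : ContDiffAt ℝ 1 (fun q : ℝ × V => fB (ex α) (K1 hα q.1 (b1 + Pc q.2))) (0, 0) := by
    refine ContDiffAt.comp (g := fB (ex α)) (0, 0) ?_ (K1_cd hα).contDiffAt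
    simp only [K1_zero]
    exact fB_contDiffAt _
  have h2 : ContDiffAt ℝ 1 (fun q : ℝ × V => fB (ex α) (K2 (α := α) hx q.1 (coord 1 q.2) (b1 + Pc q.2))) (0, 0) := by
    refine ContDiffAt.comp (g := fB (ex α)) (0, 0) ?_ (K2_cd hx).contDiffAt
    simp only [K2_zero, map_zero]
    norm_num
    exact fB_contDiffAt _
  unfold GG EE
  have h3 : ContDiffAt ℝ 1 (fun q : ℝ × V => Jop hα (b1 + Pc q.2)) (0, 0) := by fun_prop
  have h4 : ContDiffAt ℝ 1 (fun q : ℝ × V => Sop α (b1 + Pc q.2)) (0, 0) := by fun_prop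
  exact Pi0.contDiff.contDiffAt.comp (0, 0) ((h3.clm_apply h1).sub
    ((Iop (fun ω => p0 α x0 ω.1) (p0_int_mu hα hx) e0).contDiff.contDiffAt.comp (0, 0) (h4.mul h2)))

theorem GG_deriv : HasFDerivAt (fun c : V => GG hα hx (0, c)) (Dop hα hx) 0 := by
  have e : ∀ c : V, GG hα hx (0, c) = DL hα hx (b1 + Pc c) + Pi0 (Iop (fun ω => p0 α x0 ω.1) (p0_int_mu hα hx) e0 (Sop α (b1 + Pc c) *
      (1 - fB (ex α) (((coord 1 c) ^ 2 + 2 * x0 * coord 1 c) • kap x0 hx)))) := by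
    intro c
    simp only [GG, EE, K1_zero, K2_zero, fB_zero]
    simp only [DL, ContinuousLinearMap.comp_apply, ContinuousLinearMap.sub_apply, ContinuousLinearMap.apply_apply, mul_sub, map_sub, mul_one]
    abel
  simp_rw [e]
  have hc : HasFDerivAt (fun c : V => coord 1 c) (coord 1) 0 := (coord 1).hasFDerivAt
  have hq : HasFDerivAt (fun c : V => ((coord 1 c) ^ 2 + 2 * x0 * coord 1 c) • kap x0 hx)
      (((2 * x0) • coord 1).smulRight (kap x0 hx)) 0 := by
    have h := ((hc.mul hc).add (hc.const_mul (2 * x0))).smul_const (kap x0 hx)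
    have e2 : (fun c : V => ((coord 1 c) ^ 2 + 2 * x0 * coord 1 c) • kap x0 hx) =
        (fun y => (((fun c => (coord 1) c) * fun c => (coord 1) c) + fun y => 2 * x0 * (coord 1) y) y • kap x0 hx) := by
      funext c; simp only [Pi.add_apply, Pi.mul_apply, sq]
    have h' := h
    rw [← e2] at h'
    refine h'.congr_fderiv ?_
    refine ContinuousLinearMap.ext fun y => ?_
    simp
  have hf : HasFDerivAt (fun c : V => 1 - fB (ex α) (((coord 1 c) ^ 2 + 2 * x0 * coord 1 c) • kap x0 hx))
      (-((ex α • ContinuousLinearMap.id ℝ BB).comp (((2 * x0) • coord 1).smulRight (kap x0 hx)))) (0:V) := by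
    have h3 : HasFDerivAt (fB (ex α)) (ex α • ContinuousLinearMap.id ℝ BB) ((fun c : V => ((coord 1 c) ^ 2 + 2 * x0 * coord 1 c) • kap x0 hx) 0) := by
      simp only [map_zero]
      norm_num
      exact fB_deriv _
    have := (h3.comp (0:V) hq).const_sub 1
    exact this
  have hS : HasFDerivAt (fun c : V => Sop α (b1 + Pc c)) ((Sop α).comp Pc) 0 := by
    have := (Sop α).hasFDerivAt.comp (0:V) ((Pc.hasFDerivAt (x := 0)).const_add b1)
    exact this
  have hL : HasFDerivAt (fun c : V => DL hα hx (b1 + Pc c)) ((DL hα hx).comp Pc) 0 := by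
    have := (DL hα hx).hasFDerivAt.comp (0:V) ((Pc.hasFDerivAt (x := 0)).const_add b1)
    exact this
  have hM := hS.mul' hf
  have hI := (Pi0.comp (Iop (fun ω => p0 α x0 ω.1) (p0_int_mu hα hx) e0)).hasFDerivAt.comp (0:V) hM
  have := hL.add hI
  refine this.congr_fderiv ?_
  rw [Dop]
  refine ContinuousLinearMap.ext fun y => ?_
  simp [fB_zero, mul_smul_comm]
  have := Pi0_kap hα hx
  rw [this]
  simp [smul_smul]
  rw [sub_eq_add_neg, ← neg_smul, ← neg_smul]
  congr 2
  ring

theorem GG_zero (h0 : I0 α x0 = C1 α) : GG hα hx (0, 0) = 0 := by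
  simp only [GG, EE, K1_zero, K2_zero, map_zero]
  norm_num [fB_zero]
  have h := DL_single hα hx 1
  have h1 : DL hα hx b1 = 0 := by
    rw [b1, single_eq, map_smul, h, dk]
    have := I0_scale hα hx (k := 1) one_pos
    simp only [Nat.cast_one]
    rw [this]; simp [h0]
  simp [DL] at h1
  exact h1

theorem ift {E : Type*} [NormedAddCommGroup E] [NormedSpace ℝ E] [CompleteSpace E] {f : ℝ × E → E}
    (cd : ContDiffAt ℝ 1 f (0, 0)) {D : E →L[ℝ] E} (h' : HasFDerivAt (fun c : E => f (0, c)) D 0)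
    (hD : D.IsInvertible) (f0 : f (0, 0) = 0) :
    ∃ c : ℝ → E, c 0 = 0 ∧ ContDiffAt ℝ 1 c 0 ∧ ∀ᶠ a in 𝓝 (0:ℝ), f (a, c a) = 0 := by
  have hd := (cd.differentiableAt (by norm_num)).hasFDerivAt
  have h2 : fderiv ℝ f (0, 0) ∘L .inr ℝ ℝ E = D := by
    have h3 : HasFDerivAt (fun c : E => ((0:ℝ), c)) (.inr ℝ ℝ E) 0 := (ContinuousLinearMap.inr ℝ ℝ E).hasFDerivAt
    exact (HasFDerivAt.comp (0:E) hd h3).unique h'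
  have hi : (fderiv ℝ f (0, 0) ∘L .inr ℝ ℝ E).IsInvertible := by rw [h2]; exact hD
  refine ⟨cd.implicitFunction one_ne_zero hi, cd.implicitFunction_apply_self one_ne_zero hi,
    cd.contDiffAt_implicitFunction one_ne_zero hi, ?_⟩
  have ce := cd.eventually_apply_implicitFunction one_ne_zero hi
  rwa [f0] at ce


theorem K1_ev : ∀ᶠ q : ℝ × V in 𝓝 (0, 0), ‖K1 hα q.1 (b1 + Pc q.2)‖ < 1 := by
  refine ((K1_cd hα).continuous.norm.continuousAt (x := ((0:ℝ), (0:V)))).eventually_lt_const ?_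
  simp [K1_zero]

theorem K2_ev : ∀ᶠ q : ℝ × V in 𝓝 (0, 0), ‖K2 (α := α) hx q.1 (coord 1 q.2) (b1 + Pc q.2)‖ < 1 := by
  refine ((K2_cd (α := α) hx).continuous.norm.continuousAt (x := ((0:ℝ), (0:V)))).eventually_lt_const ?_
  simp [K2_zero]

theorem exists_branch (h0 : I0 α x0 = C1 α) : ∃ c : ℝ → V, c 0 = 0 ∧
    ∀ᶠ a in 𝓝 (0:ℝ), ContinuousAt c a ∧ Pi0 (EE hα hx a (coord 1 (c a)) (b1 + Pc (c a))) = 0 ∧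
      ‖K1 hα a (b1 + Pc (c a))‖ < 1 ∧ ‖K2 (α := α) hx a (coord 1 (c a)) (b1 + Pc (c a))‖ < 1 := by
  obtain ⟨c, c0, cc, ce⟩ := ift (GG_cd hα hx) (GG_deriv hα hx) (Dop_inv hα hx h0) (GG_zero hα hx h0)
  have hq : Tendsto (fun a : ℝ => (a, c a)) (𝓝 0) (𝓝 ((0:ℝ), (0:V))) := by
    have h := (continuousAt_id (x := (0:ℝ))).prodMk cc.continuousAt
    have h2 : Tendsto (fun a : ℝ => (a, c a)) (𝓝 0) (𝓝 ((0:ℝ), c 0)) := h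
    rwa [c0] at h2
  have t1 := hq.eventually (K1_ev hα)
  have t2 := hq.eventually (K2_ev (α := α) hx)
  have t3 : ∀ᶠ a in 𝓝 (0:ℝ), ContDiffAt ℝ 1 c a := cc.eventually (by simp)
  refine ⟨c, c0, ?_⟩
  filter_upwards [t3, ce, t1, t2] with a a1 a2 a3 a4
  exact ⟨a1.continuousAt, a2, a3, a4⟩

end
end
end DB

namespace DB
noncomputable section

/-! ### pointwise theory of `Fa` -/

theorem ff_cont (α : ℝ) : Continuous fun τ : ℝ => (1 + τ ^ 2) ^ ex α :=
  Continuous.rpow_const (by fun_prop) fun τ => Or.inl (by positivity)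

theorem Fa_deriv (α q : ℝ) : HasDerivAt (Fa α) ((1 + q ^ 2) ^ ex α) q :=
  (ff_cont α).integral_hasStrictDerivAt 0 q |>.hasDerivAt

theorem Fa_cont (α : ℝ) : Continuous (Fa α) :=
  continuous_iff_continuousAt.2 fun q => (Fa_deriv α q).continuousAt

theorem Fa_neg (α q : ℝ) : Fa α (-q) = - Fa α q := by
  have := intervalIntegral.integral_comp_neg (a := 0) (b := q) (fun τ : ℝ => (1 + τ ^ 2) ^ (-(2 + α) / 2))
  simp only [neg_sq, neg_zero] at this
  rw [Fa, Fa, this, intervalIntegral.integral_symm]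

theorem Fa_step (α p d : ℝ) : Fa α (p + d) - Fa α p = ∫ θ in (0:ℝ)..1, d * (1 + (p + θ * d) ^ 2) ^ ex α := by
  have h : ∀ θ ∈ Set.uIcc (0:ℝ) 1, HasDerivAt (fun θ => Fa α (p + θ * d)) (d * (1 + (p + θ * d) ^ 2) ^ ex α) θ := by
    intro θ _
    have h1 : HasDerivAt (fun θ : ℝ => p + θ * d) d θ := by
      simpa using ((hasDerivAt_id θ).mul_const d).const_add p
    have := (Fa_deriv α (p + θ * d)).comp θ h1
    rwa [mul_comm] at this
  have hc : Continuous fun θ : ℝ => d * (1 + (p + θ * d) ^ 2) ^ ex α :=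
    continuous_const.mul ((ff_cont α).comp (by fun_prop : Continuous fun θ : ℝ => p + θ * d))
  rw [intervalIntegral.integral_eq_sub_of_hasDerivAt h (hc.intervalIntegrable _ _)]
  simp

def CF (α : ℝ) : ℝ := ∫ τ : ℝ, (1 + τ ^ 2) ^ ex α

theorem Fa_bound {α : ℝ} (hα : α ∈ Set.Ioo (0:ℝ) 1) (q : ℝ) : |Fa α q| ≤ CF α := by
  have h := intervalIntegral.norm_integral_le_integral_norm_uIoc (μ := volume) (a := 0) (b := q)
    (f := fun τ : ℝ => (1 + τ ^ 2) ^ (-(2 + α) / 2))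
  refine (show |Fa α q| ≤ _ from h).trans ?_
  have : ∀ τ : ℝ, ‖(1 + τ ^ 2) ^ (-(2 + α) / 2)‖ = (1 + τ ^ 2) ^ ex α := fun τ =>
    Real.norm_of_nonneg (by positivity)
  simp_rw [this]
  exact setIntegral_le_integral (f_int hα) (Eventually.of_forall fun τ => by simp only [Pi.zero_apply]; positivity)

theorem FaInf_sub {α : ℝ} (hα : α ∈ Set.Ioo (0:ℝ) 1) (q : ℝ) :
    FaInf α - Fa α q = ∫ τ in Set.Ioi q, (1 + τ ^ 2) ^ ex α := by
  have := intervalIntegral.integral_interval_add_Ioi (μ := volume) (f := fun τ : ℝ => (1 + τ ^ 2) ^ ex α) (a := 0) (b := q)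
    (f_int hα).integrableOn (f_int hα).integrableOn
  have h1 : FaInf α = ∫ τ in Set.Ioi (0:ℝ), (1 + τ ^ 2) ^ ex α := rfl
  have h2 : Fa α q = ∫ τ in (0:ℝ)..q, (1 + τ ^ 2) ^ ex α := rfl
  rw [h1, h2, ← this]; ring

theorem FaInf_sub_pos {α : ℝ} (hα : α ∈ Set.Ioo (0:ℝ) 1) (q : ℝ) : 0 < FaInf α - Fa α q := by
  rw [FaInf_sub hα, setIntegral_pos_iff_support_of_nonneg_ae (Eventually.of_forall fun τ => by simp only [Pi.zero_apply]; positivity)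
    (f_int hα).integrableOn]
  have : Function.support (fun τ : ℝ => (1 + τ ^ 2) ^ ex α) = Set.univ := by
    ext τ; simp only [Function.mem_support, Set.mem_univ, iff_true]; positivity
  rw [this, Set.univ_inter]; simp

theorem FaInf_sub_le1 {α : ℝ} (hα : α ∈ Set.Ioo (0:ℝ) 1) (q : ℝ) : FaInf α - Fa α q ≤ CF α := by
  rw [FaInf_sub hα]
  exact setIntegral_le_integral (f_int hα) (Eventually.of_forall fun τ => by simp only [Pi.zero_apply]; positivity)

theorem FaInf_sub_le2 {α : ℝ} (hα : α ∈ Set.Ioo (0:ℝ) 1) {q : ℝ} (hq : 0 < q) :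
    FaInf α - Fa α q ≤ q ^ (-(1 + α)) / (1 + α) := by
  have h1 : -(2 + α) < -1 := by linarith [hα.1]
  rw [FaInf_sub hα]
  calc _ ≤ ∫ τ in Set.Ioi q, τ ^ (-(2 + α)) := by
        refine setIntegral_mono_on (f_int hα).integrableOn (integrableOn_Ioi_rpow_of_lt h1 hq) measurableSet_Ioi ?_
        intro τ hτ
        have h0 : 0 < τ := hq.trans hτ
        have : τ ^ (-(2 + α)) = (τ ^ 2) ^ ex α := by
          rw [← Real.rpow_natCast, ← Real.rpow_mul h0.le, ex]; congr 1; push_cast; ring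
        rw [this]
        exact Real.rpow_le_rpow_of_nonpos (by positivity) (by linarith) (by unfold ex; linarith [hα.1])
    _ = _ := by
        rw [integral_Ioi_rpow_of_lt h1 hq, show -(2 + α) + 1 = -(1 + α) by ring, neg_div_neg_eq]

theorem tail_int {α : ℝ} (hα : α ∈ Set.Ioo (0:ℝ) 1) {ε : ℝ} (hε : 0 < ε) :
    IntegrableOn (fun t : ℝ => |t| ^ (-(1 + α))) {t : ℝ | ε ≤ |t|} := by
  have hm : MeasurableSet {t : ℝ | ε ≤ |t|} := measurableSet_le measurable_const measurable_id.abs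
  rw [← integrable_indicator_iff hm]
  have h1 : IntegrableOn (fun t : ℝ => t ^ (-(1 + α))) (Set.Ici ε) := by
    rw [integrableOn_Ici_iff_integrableOn_Ioi]
    exact integrableOn_Ioi_rpow_of_lt (by linarith [hα.1]) hε
  have h2 := integrable_abs ((integrable_indicator_iff measurableSet_Ici).2 h1).integrableOn
  refine h2.congr (Eventually.of_forall fun t => ?_)
  simp only [Set.indicator, Set.mem_Ici, Set.mem_setOf_eq]

theorem kt_meas {α : ℝ} {g : ℝ → ℝ} (hg : Continuous g) : Measurable fun t : ℝ => Fa α (g t / |t|) * |t| ^ (-(1 + α)) :=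
  ((Fa_cont α).measurable.comp (hg.measurable.div measurable_id.abs)).mul (meas_abs_rpow _)

theorem kt_meas' {α : ℝ} {g : ℝ → ℝ} (hg : Continuous g) : Measurable fun t : ℝ => (Fa α (g t / |t|) - FaInf α) * |t| ^ (-(1 + α)) :=
  (((Fa_cont α).measurable.comp (hg.measurable.div measurable_id.abs)).sub_const _).mul (meas_abs_rpow _)

theorem kt_int {α : ℝ} (hα : α ∈ Set.Ioo (0:ℝ) 1) {x : ℝ} (hx : 0 < x) :
    Integrable fun t : ℝ => (Fa α (x / |t|) - FaInf α) * |t| ^ (-(1 + α)) := by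
  have hm : MeasurableSet {t : ℝ | 1 ≤ |t|} := measurableSet_le measurable_const measurable_id.abs
  have b1 := ((integrable_indicator_iff hm).2 (tail_int hα one_pos)).const_mul (CF α)
  have b2 : Integrable ((Set.Icc (-1:ℝ) 1).indicator fun _ => x ^ (-(1 + α)) / (1 + α)) :=
    (integrable_indicator_iff measurableSet_Icc).2 (integrableOn_const (by simp) (by simp))
  refine (b1.add b2).mono' (kt_meas' continuous_const).aestronglyMeasurable ?_
  have h1 : ∀ᵐ τ : ℝ, τ ≠ 0 := by simp [ae_iff]
  have ha := hα.1
  filter_upwards [h1] with t ht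
  have ht' : 0 < |t| := abs_pos.2 ht
  have hp := FaInf_sub_pos hα (x / |t|)
  have hC : 0 ≤ CF α := hp.le.trans (FaInf_sub_le1 hα _)
  rw [Real.norm_eq_abs, abs_mul, abs_sub_comm, abs_of_pos hp, abs_of_nonneg (by positivity : 0 ≤ |t| ^ (-(1 + α)))]
  simp only [Pi.add_apply, Set.indicator, Set.mem_setOf_eq, Set.mem_Icc, ← abs_le]
  rcases le_total 1 |t| with h | h
  · have : 0 ≤ if |t| ≤ 1 then x ^ (-(1 + α)) / (1 + α) else 0 := by split_ifs <;> positivity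
    rw [if_pos h]
    have := mul_le_mul_of_nonneg_right (FaInf_sub_le1 hα (x / |t|)) (by positivity : 0 ≤ |t| ^ (-(1 + α)))
    linarith
  · have h0 : 0 ≤ CF α * if 1 ≤ |t| then |t| ^ (-(1 + α)) else 0 := by split_ifs <;> positivity
    rw [if_pos h]
    have := mul_le_mul_of_nonneg_right (FaInf_sub_le2 hα (div_pos hx ht')) (by positivity : 0 ≤ |t| ^ (-(1 + α)))
    have e : (x / |t|) ^ (-(1 + α)) / (1 + α) * |t| ^ (-(1 + α)) = x ^ (-(1 + α)) / (1 + α) := by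
      rw [Real.div_rpow hx.le ht'.le]
      have : |t| ^ (-(1 + α)) ≠ 0 := by positivity
      field_simp
    linarith

def hR (α x : ℝ) : ℝ := -2 * ∫ t : ℝ, (Fa α (x / |t|) - FaInf α) * |t| ^ (-(1 + α))

theorem hR_pos {α : ℝ} (hα : α ∈ Set.Ioo (0:ℝ) 1) {x : ℝ} (hx : 0 < x) : 0 < hR α x := by
  have : 0 < ∫ t : ℝ, -((Fa α (x / |t|) - FaInf α) * |t| ^ (-(1 + α))) := by
    refine integral_pos' (kt_int hα hx).neg (fun t => ?_) fun t ht => ?_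
    · have := FaInf_sub_pos hα (x / |t|)
      have h2 : 0 ≤ |t| ^ (-(1 + α)) := by positivity
      nlinarith
    · have := FaInf_sub_pos hα (x / |t|)
      have h2 : 0 < |t| := abs_pos.2 ht.1.ne'
      have h3 : 0 < |t| ^ (-(1 + α)) := by positivity
      nlinarith
  rw [integral_neg] at this
  unfold hR; linarith

/-! ### curvature from e1, e2 -/

def E1 (α a : ℝ) (φ : ℝ → ℝ) (σ τ : ℝ) : ℝ := ∫ θ in Set.Icc (0:ℝ) 1, e1 α a φ σ (τ, θ)
def E2 (α x a : ℝ) (φ : ℝ → ℝ) (σ τ : ℝ) : ℝ := ∫ θ in Set.Icc (0:ℝ) 1, e2 α x a φ σ (τ, θ)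

theorem e_scale {τ : ℝ} (α : ℝ) (hτ : τ ≠ 0) (y : ℝ) : |τ| ^ (-(2 + α)) * (1 + (y / |τ|) ^ 2) ^ ex α = (τ ^ 2 + y ^ 2) ^ ex α := by
  have h := p0_scale α (abs_pos.2 hτ) y
  rw [p0, sq_abs] at h
  rw [← h, add_comm]

theorem rp_succ {τ : ℝ} (α : ℝ) (hτ : τ ≠ 0) : |τ|⁻¹ * |τ| ^ (-(1 + α)) = |τ| ^ (-(2 + α)) := by
  have h := abs_pos.2 hτ
  rw [← Real.rpow_neg_one, ← Real.rpow_add h]; congr 1; ring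

theorem E2_eq {α x a : ℝ} {φ : ℝ → ℝ} {σ τ : ℝ} (hτ : τ ≠ 0) :
    (Fa α ((x + a * ss φ σ τ) / |τ|) - Fa α (x / |τ|)) * |τ| ^ (-(1 + α)) = a * E2 α x a φ σ τ := by
  have h := Fa_step α (x / |τ|) (a * ss φ σ τ / |τ|)
  rw [← add_div] at h
  rw [h, E2, ← intervalIntegral.integral_mul_const, intervalIntegral.integral_of_le zero_le_one,
    ← integral_Icc_eq_integral_Ioc, ← integral_const_mul]
  refine integral_congr_ae (Eventually.of_forall fun θ => ?_)
  simp only [e2]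
  rw [← e_scale α hτ, ← rp_succ α hτ]
  have : x / |τ| + θ * (a * ss φ σ τ / |τ|) = (x + θ * a * ss φ σ τ) / |τ| := by ring
  rw [this]
  ring

theorem E1_eq {α a : ℝ} {φ : ℝ → ℝ} {σ τ : ℝ} (hτ : τ ≠ 0) :
    (Fa α (a * (φ σ - φ (σ - τ)) / |τ|) + Fa α (a * (φ σ - φ (σ + τ)) / |τ|)) * |τ| ^ (-(1 + α)) = 2 * (a * E1 α a φ σ τ) := by
  have h := Fa_step α (-(a * (φ σ - φ (σ + τ)) / |τ|)) (a * (2 * dl φ σ τ) / |τ|)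
  have e : -(a * (φ σ - φ (σ + τ)) / |τ|) + (a * (2 * dl φ σ τ) / |τ|) = a * (φ σ - φ (σ - τ)) / |τ| := by
    unfold dl; ring
  rw [e, Fa_neg, sub_neg_eq_add] at h
  rw [h, E1, ← intervalIntegral.integral_mul_const, intervalIntegral.integral_of_le zero_le_one,
    ← integral_Icc_eq_integral_Ioc, ← integral_const_mul, ← integral_const_mul]
  refine integral_congr_ae (Eventually.of_forall fun θ => ?_)
  simp only [e1]
  have : (-(a * (φ σ - φ (σ + τ)) / |τ|) + θ * (a * (2 * dl φ σ τ) / |τ|)) ^ 2 = a ^ 2 * rr φ σ τ θ ^ 2 := by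
    have h1 : -(a * (φ σ - φ (σ + τ)) / |τ|) + θ * (a * (2 * dl φ σ τ) / |τ|) =
      a * (θ * (φ σ - φ (σ - τ)) - (1 - θ) * (φ σ - φ (σ + τ))) / |τ| := by unfold dl; ring
    have h2 : rr φ σ τ θ = (θ * (φ σ - φ (σ - τ)) - (1 - θ) * (φ σ - φ (σ + τ))) / τ := by
      unfold rr; field_simp; ring
    rw [h1, h2, div_pow, div_pow, sq_abs]; ring
  rw [this, ← rp_succ α hτ]
  ring

theorem hasNMC_core {α : ℝ} (hα : α ∈ Set.Ioo (0:ℝ) 1) {x a : ℝ} (hx : 0 < x) {φ : ℝ → ℝ} (hφ : Continuous φ) (σ : ℝ)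
    (i1 : Integrable (e1 α a φ σ) mu) (i2 : Integrable (e2 α x a φ σ) mu)
    (heq : ∫ ω, e1 α a φ σ ω ∂mu = ∫ ω, e2 α x a φ σ ω ∂mu) :
    HasNMC α (fun s => x / 2 + a * φ s) σ (hR α x) := by
  have j1 : Integrable (E1 α a φ σ) := by rw [mu] at i1; exact i1.integral_prod_left
  have j2 : Integrable (E2 α x a φ σ) := by rw [mu] at i2; exact i2.integral_prod_left
  have k1 : ∫ ω, e1 α a φ σ ω ∂mu = ∫ τ, E1 α a φ σ τ := by rw [mu] at i1 ⊢; exact integral_prod _ i1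
  have k2 : ∫ ω, e2 α x a φ σ ω ∂mu = ∫ τ, E2 α x a φ σ τ := by rw [mu] at i2 ⊢; exact integral_prod _ i2
  have h0 : ∀ᵐ τ : ℝ, τ ≠ 0 := by simp [ae_iff]
  have m2 : (fun t : ℝ => (Fa α (x / |t|) - FaInf α) * |t| ^ (-(1 + α)) + a * E2 α x a φ σ t) =ᵐ[volume]
      (fun t : ℝ => (Fa α ((x / 2 + a * φ σ + (x / 2 + a * φ (σ - t))) / |t|) - FaInf α) * |t| ^ (-(1 + α))) := by
    filter_upwards [h0] with t ht
    rw [← E2_eq ht]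
    have : x / 2 + a * φ σ + (x / 2 + a * φ (σ - t)) = x + a * ss φ σ t := by unfold ss; ring
    rw [this]; ring
  refine ⟨a * ∫ τ, E1 α a φ σ τ, ?_, ((kt_int hα hx).add (j2.const_mul a)).congr m2, ?_⟩
  · have hm : ∀ ε : ℝ, MeasurableSet {t : ℝ | ε ≤ |t|} := fun ε => measurableSet_le measurable_const measurable_id.abs
    have key : ∀ ε : ℝ, 0 < ε → ∫ t in {t : ℝ | ε ≤ |t|}, Fa α ((x / 2 + a * φ σ - (x / 2 + a * φ (σ - t))) / |t|) * |t| ^ (-(1 + α))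
        = ∫ t, {t : ℝ | ε ≤ |t|}.indicator (fun t => a * E1 α a φ σ t) t := by
      intro ε hε
      rw [← integral_indicator (hm ε)]
      set g : ℝ → ℝ := {t : ℝ | ε ≤ |t|}.indicator (fun t => Fa α ((x / 2 + a * φ σ - (x / 2 + a * φ (σ - t))) / |t|) * |t| ^ (-(1 + α))) with hg
      have gi : Integrable g := by
        rw [hg, integrable_indicator_iff (hm ε)]
        refine ((tail_int hα hε).const_mul (CF α)).mono' (kt_meas (g := fun t => x / 2 + a * φ σ - (x / 2 + a * φ (σ - t)))
          (by fun_prop)).aestronglyMeasurable ?_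
        refine Eventually.of_forall fun t => ?_
        rw [norm_mul, Real.norm_eq_abs, Real.norm_of_nonneg (by positivity : 0 ≤ |t| ^ (-(1 + α)))]
        exact mul_le_mul_of_nonneg_right (Fa_bound hα _) (by positivity)
      have gn : ∫ t, g (-t) = ∫ t, g t := integral_neg_eq_self g volume
      have : ∫ t, g t = (1 / 2) * ∫ t, (g t + g (-t)) := by
        rw [integral_add gi gi.comp_neg, gn]; ring
      rw [this, ← integral_const_mul]
      refine integral_congr_ae ?_
      filter_upwards [h0] with t ht
      simp only [hg, Set.indicator, Set.mem_setOf_eq, abs_neg]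
      split_ifs with hh
      · have := E1_eq (α := α) (a := a) (φ := φ) (σ := σ) ht
        rw [sub_neg_eq_add, ← add_mul]
        rw [show x / 2 + a * φ σ - (x / 2 + a * φ (σ - t)) = a * (φ σ - φ (σ - t)) by ring,
          show x / 2 + a * φ σ - (x / 2 + a * φ (σ + t)) = a * (φ σ - φ (σ + t)) by ring, this]
        ring
      · simp
    have lim : Tendsto (fun ε : ℝ => ∫ t, {t : ℝ | ε ≤ |t|}.indicator (fun t => a * E1 α a φ σ t) t) (𝓝[>] 0)
        (𝓝 (∫ t, a * E1 α a φ σ t)) := by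
      refine tendsto_integral_filter_of_dominated_convergence (fun t => ‖a * E1 α a φ σ t‖)
        (Eventually.of_forall fun ε => ((j1.const_mul a).indicator (hm ε)).aestronglyMeasurable)
        (Eventually.of_forall fun ε => Eventually.of_forall fun t => ?_) (j1.const_mul a).norm ?_
      · exact norm_indicator_le_norm_self _ _
      · filter_upwards [h0] with t ht
        refine tendsto_const_nhds.congr' ?_
        have : ∀ᶠ ε in 𝓝[>] (0:ℝ), ε < |t| := nhdsWithin_le_nhds (Iio_mem_nhds (abs_pos.2 ht))
        filter_upwards [this] with ε hε
        rw [Set.indicator_of_mem]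
        exact hε.le
    rw [integral_const_mul] at lim
    refine lim.congr' ?_
    filter_upwards [self_mem_nhdsWithin] with ε hε
    exact (key ε hε).symm
  · rw [← integral_congr_ae m2, integral_add (kt_int hα hx) (j2.const_mul a), integral_const_mul, ← k1, ← k2, heq, hR]
    ring

/-! ### scaling -/

theorem scale_int {α l : ℝ} (hl : 0 < l) (Ψ : ℝ → ℝ) :
    ∫ t, Ψ (l * t) * |t| ^ (-(1 + α)) = l ^ α * ∫ t, Ψ t * |t| ^ (-(1 + α)) := by
  have h := Measure.integral_comp_mul_left (fun t => Ψ t * |t| ^ (-(1 + α))) l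
  have e : ∀ t, Ψ t * |t| ^ (-(1 + α)) = Ψ t * |t| ^ (-(1 + α)) := fun _ => rfl
  have e2 : ∀ t, Ψ (l * t) * |t| ^ (-(1 + α)) = l ^ (1 + α) * (Ψ (l * t) * |l * t| ^ (-(1 + α))) := by
    intro t
    rw [abs_mul, abs_of_pos hl, Real.mul_rpow hl.le (abs_nonneg t), Real.rpow_neg hl.le]
    field_simp
  simp_rw [e2]
  rw [integral_const_mul, h, abs_of_pos (inv_pos.2 hl), smul_eq_mul, ← mul_assoc, Real.rpow_add hl, Real.rpow_one]
  congr 1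
  field_simp

theorem scale_integrable {α l : ℝ} (hl : 0 < l) (Ψ : ℝ → ℝ) (h : Integrable fun t => Ψ t * |t| ^ (-(1 + α))) :
    Integrable fun t => Ψ (l * t) * |t| ^ (-(1 + α)) := by
  refine ((h.comp_mul_left' hl.ne').const_mul (l ^ (1 + α))).congr (Eventually.of_forall fun t => ?_)
  simp only
  rw [abs_mul, abs_of_pos hl, Real.mul_rpow hl.le (abs_nonneg t), Real.rpow_neg hl.le]
  field_simp

theorem hR_scale {α l x : ℝ} (hl : 0 < l) : hR α x = l ^ α * hR α (l * x) := by
  have := scale_int (α := α) hl (fun t => Fa α (l * x / |t|) - FaInf α)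
  rw [hR, hR, ← mul_assoc, mul_comm (l ^ α), mul_assoc, ← this]
  congr 2
  ext1 t
  rw [abs_mul, abs_of_pos hl, mul_div_mul_left _ _ hl.ne']

theorem hasNMC_scale {α l : ℝ} (hl : 0 < l) {u : ℝ → ℝ} {s h : ℝ} (H : HasNMC α u (l * s) h) :
    HasNMC α (fun s => u (l * s) / l) s (l ^ α * h) := by
  obtain ⟨I, h1, h2, h3⟩ := H
  have q : ∀ (A B t : ℝ), (A / l - B / l) / |t| = (A - B) / |l * t| := by
    intro A B t
    rw [abs_mul, abs_of_pos hl, ← sub_div, div_div]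
  have q' : ∀ (A B t : ℝ), (A / l + B / l) / |t| = (A + B) / |l * t| := by
    intro A B t
    rw [abs_mul, abs_of_pos hl, ← add_div, div_div]
  have e2 := scale_int (α := α) hl (fun t => Fa α ((u (l * s) + u (l * s - t)) / |t|) - FaInf α)
  have i2 := scale_integrable (α := α) hl (fun t => Fa α ((u (l * s) + u (l * s - t)) / |t|) - FaInf α) h2
  refine ⟨l ^ α * I, ?_, ?_, ?_⟩
  · have ht : Tendsto (fun ε : ℝ => l * ε) (𝓝[>] 0) (𝓝[>] 0) := by
      refine tendsto_nhdsWithin_iff.2 ⟨?_, ?_⟩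
      · have : Tendsto (fun ε : ℝ => l * ε) (𝓝 0) (𝓝 (l * 0)) := (continuous_const.mul continuous_id).tendsto 0
        rw [mul_zero] at this
        exact this.mono_left nhdsWithin_le_nhds
      · filter_upwards [self_mem_nhdsWithin] with ε hε
        exact mul_pos hl hε
    refine ((h1.comp ht).const_mul (l ^ α)).congr fun ε => ?_
    have hm : ∀ ε : ℝ, MeasurableSet {t : ℝ | ε ≤ |t|} := fun ε => measurableSet_le measurable_const measurable_id.abs
    simp only [Function.comp]
    rw [← integral_indicator (hm _), ← integral_indicator (hm _)]
    have e1 := scale_int (α := α) hl ({t : ℝ | l * ε ≤ |t|}.indicator fun t => Fa α ((u (l * s) - u (l * s - t)) / |t|))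
    have a1 : ∀ t, {t : ℝ | l * ε ≤ |t|}.indicator (fun t => Fa α ((u (l * s) - u (l * s - t)) / |t|) * |t| ^ (-(1 + α))) t =
      {t : ℝ | l * ε ≤ |t|}.indicator (fun t => Fa α ((u (l * s) - u (l * s - t)) / |t|)) t * |t| ^ (-(1 + α)) := by
      intro t; simp only [Set.indicator]; split_ifs <;> simp
    simp_rw [a1]
    rw [← e1]
    congr 1; ext1 t
    have : l * ε ≤ |l * t| ↔ ε ≤ |t| := by rw [abs_mul, abs_of_pos hl, mul_le_mul_iff_right₀ hl]
    simp only [Set.indicator, Set.mem_setOf_eq, this, q, mul_sub]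
    split_ifs <;> simp
  · refine i2.congr (Eventually.of_forall fun t => ?_)
    simp only [q', mul_sub]
  · simp only [q', mul_sub]
    rw [e2, h3]; ring

theorem hasNMC_branch {α : ℝ} (hα : α ∈ Set.Ioo (0:ℝ) 1) {x0 : ℝ} (hx : 0 < x0) {a δ : ℝ} {b : V}
    (h1 : ‖K1 hα a b‖ < 1) (h2 : ‖K2 (α := α) hx a δ b‖ < 1) (hd : 0 < x0 + δ)
    (h0 : Pi0 (EE hα hx a δ b) = 0) (s : ℝ) :
    HasNMC α (fun s => x0 / 2 + a / ((x0 + δ) / x0) * phi α ((x0 + δ) / x0 * s) b) s (hR α x0) := by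
  have hl : 0 < (x0 + δ) / x0 := by positivity
  set l := (x0 + δ) / x0 with hl'
  obtain ⟨-, i1, i2⟩ := ev_EE hα hx h1 h2 (l * s)
  have H := hasNMC_scale hl (hasNMC_core hα hd (phi_cont α b) (l * s) i1 i2 (EE_zero hα hx h1 h2 h0 (l * s)))
  have e : x0 + δ = l * x0 := by rw [hl']; field_simp
  rw [e, ← hR_scale hl] at H
  convert H using 2
  field_simp

end
end DB

namespace DB
noncomputable section

/-! ### regularity and Fourier coefficients of `phi` -/

theorem wk_mul_sq (α : ℝ) (k : ℕ) : wk α k * (k:ℝ) ^ 2 ≤ 2 := by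
  have h := nk_one_le α k
  have h0 := wk_pos α k
  have h1 := wk_mul α k
  have h2 : (nk α k)⁻¹ ≤ 1 := inv_le_one_of_one_le₀ h
  have h3 : (k:ℝ) ^ 2 ≤ 2 * 2 ^ k := sq_le_two_pow k
  nlinarith [mul_le_mul_of_nonneg_left h3 h0.le]

theorem wk_mul_k (α : ℝ) (k : ℕ) : wk α k * (k:ℝ) ≤ 2 := by
  have h := wk_mul_sq α k
  have h0 := wk_pos α k
  have : (k:ℝ) ≤ (k:ℝ) ^ 2 := by
    have : k ≤ k ^ 2 := Nat.le_self_pow (by norm_num) k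
    exact_mod_cast this
  nlinarith [mul_le_mul_of_nonneg_left this h0.le]

def dphi (α σ : ℝ) : V →L[ℝ] ℝ := rlift (fun k => wk α k * (-(k * sin (k * σ)))) 2 (fun k => by
  rw [norm_mul, Real.norm_of_nonneg (wk_pos α k).le, norm_neg, norm_mul, Real.norm_natCast, ← mul_assoc]
  calc _ ≤ wk α k * k * 1 := by
        gcongr
        · exact mul_nonneg (wk_pos α k).le (Nat.cast_nonneg k)
        · exact abs_sin_le_one _
    _ ≤ 2 := by simpa using wk_mul_k α k)

theorem dphi_hasSum (α σ : ℝ) (c : V) :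
    HasSum (fun k => c k * (wk α k * (-(k * sin (k * σ))))) (dphi α σ c) :=
  rlift_hasSum (fun k => wk α k * (-(k * sin (k * σ)))) 2 _ c

theorem dphi_bound (α σ : ℝ) (c : V) : |dphi α σ c| ≤ 2 * ‖c‖ :=
  rlift_norm (fun k => wk α k * (-(k * sin (k * σ)))) 2 _ c

theorem sin_lip (x y : ℝ) : |sin x - sin y| ≤ |x - y| := by
  have := Real.sin_sub_sin x y
  rw [this, abs_mul, abs_mul]
  have h1 : |sin ((x - y) / 2)| ≤ |(x - y) / 2| := Real.abs_sin_le_abs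
  have h2 := abs_cos_le_one ((x + y) / 2)
  rw [abs_div] at h1
  simp only [Nat.abs_ofNat] at *
  nlinarith [abs_nonneg (sin ((x - y) / 2)), abs_nonneg (cos ((x + y) / 2)), abs_nonneg (x - y)]

theorem dphi_lip (α σ σ' : ℝ) (c : V) : |dphi α σ c - dphi α σ' c| ≤ 2 * |σ - σ'| * ‖c‖ := by
  have hb : ∀ k : ℕ, ‖wk α k * (-(k * sin (k * σ))) - wk α k * (-(k * sin (k * σ')))‖ ≤ 2 * |σ - σ'| := by
    intro k
    have e : wk α k * (-(k * sin (k * σ))) - wk α k * (-(k * sin (k * σ'))) =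
      -(wk α k * k * (sin (k * σ) - sin (k * σ'))) := by ring
    have hp : 0 ≤ wk α k * k := mul_nonneg (wk_pos α k).le (Nat.cast_nonneg k)
    rw [e, norm_neg, norm_mul, Real.norm_of_nonneg hp]
    calc _ ≤ wk α k * k * |k * σ - k * σ'| := by
          gcongr; exact sin_lip _ _
      _ = (wk α k * (k:ℝ) ^ 2) * |σ - σ'| := by
          rw [← mul_sub, abs_mul, Nat.abs_cast]; ring
      _ ≤ _ := by gcongr; exact wk_mul_sq α k
  have h1 := (dphi_hasSum α σ c).sub (dphi_hasSum α σ' c)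
  have h2 := rlift_hasSum (fun k => wk α k * (-(k * sin (k * σ))) - wk α k * (-(k * sin (k * σ')))) _ hb c
  have h3 := rlift_norm (fun k => wk α k * (-(k * sin (k * σ))) - wk α k * (-(k * sin (k * σ')))) _ hb c
  have : dphi α σ c - dphi α σ' c = rlift (fun k => wk α k * (-(k * sin (k * σ))) - wk α k * (-(k * sin (k * σ')))) _ hb c := by
    refine h1.unique ?_
    convert h2 using 2
    simp only [smul_eq_mul]; ring
  rw [this]; exact h3

theorem phi_deriv (α σ : ℝ) (c : V) : HasDerivAt (fun σ => phi α σ c) (dphi α σ c) σ := by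
  have h := hasDerivAt_tsum (𝕜 := ℝ) (u := fun k => ‖c k‖ * 2) (g := fun (k:ℕ) σ => c k * (wk α k * cos (k * σ)))
    (g' := fun (k:ℕ) σ => c k * (wk α k * (-(k * sin (k * σ))))) ((l1_summable c).mul_right 2)
    (fun k y => by
      have h1 : HasDerivAt (fun σ : ℝ => (k:ℝ) * σ) k y := by simpa using (hasDerivAt_id y).const_mul (k:ℝ)
      have := ((h1.cos).const_mul (wk α k)).const_mul (c k)
      exact this.congr_deriv (by ring))
    (fun k y => by
      rw [norm_mul]
      gcongr
      rw [norm_mul, Real.norm_of_nonneg (wk_pos α k).le, norm_neg, norm_mul, Real.norm_natCast, ← mul_assoc]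
      calc _ ≤ wk α k * k * 1 := by
            gcongr
            · exact mul_nonneg (wk_pos α k).le (Nat.cast_nonneg k)
            · exact abs_sin_le_one _
        _ ≤ 2 := by simpa using wk_mul_k α k)
    (phi_hasSum α 0 c).summable σ
  rw [(dphi_hasSum α σ c).tsum_eq] at h
  have e : (fun σ => phi α σ c) = fun z => ∑' k : ℕ, c k * (wk α k * cos (k * z)) :=
    funext fun y => (phi_hasSum α y c).tsum_eq.symm
  rw [e]; exact h

theorem phi_deriv' (α : ℝ) (c : V) : deriv (fun σ => phi α σ c) = fun σ => dphi α σ c :=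
  funext fun σ => (phi_deriv α σ c).deriv

theorem dphi_cont (α : ℝ) (c : V) : Continuous fun σ => dphi α σ c := by
  have : LipschitzWith (2 * ‖c‖₊) fun σ => dphi α σ c := LipschitzWith.of_dist_le_mul fun x y => by
    have := dphi_lip α x y c
    rw [Real.dist_eq, Real.dist_eq]
    push_cast; linarith
  exact this.continuous

theorem phi_contDiff (α : ℝ) (c : V) : ContDiff ℝ 1 fun σ => phi α σ c := by
  rw [contDiff_one_iff_deriv]
  refine ⟨fun σ => (phi_deriv α σ c).differentiableAt, ?_⟩
  rw [phi_deriv']; exact dphi_cont α c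

theorem dphi_holder (α σ σ' : ℝ) (c : V) {β : ℝ} (h0 : 0 < β) (h1 : β < 1) :
    |dphi α σ c - dphi α σ' c| ≤ 4 * ‖c‖ * |σ - σ'| ^ β := by
  have hn := norm_nonneg c
  rcases le_total |σ - σ'| 1 with h | h
  · have := Real.rpow_le_rpow_of_exponent_ge' (abs_nonneg (σ - σ')) h h0.le h1.le
    rw [Real.rpow_one] at this
    have := dphi_lip α σ σ' c
    nlinarith [mul_nonneg hn (abs_nonneg (σ - σ')), mul_le_mul_of_nonneg_left ‹|σ - σ'| ≤ _› hn]
  · have h2 := Real.one_le_rpow h h0.le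
    have h3 := abs_sub (dphi α σ c) (dphi α σ' c)
    have h4 := dphi_bound α σ c
    have h5 := dphi_bound α σ' c
    nlinarith

theorem phi_periodic (α : ℝ) (c : V) : Function.Periodic (fun σ => phi α σ c) (2 * π) := by
  intro σ
  refine (phi_hasSum α (σ + 2 * π) c).unique ?_
  convert phi_hasSum α σ c using 4 with k
  rw [mul_add, Real.cos_add_nat_mul_two_pi]

theorem int_cos_lin (m : ℤ) (θ : ℝ) (hm : m ≠ 0) : ∫ σ in (0:ℝ)..(2 * π), cos (m * σ + θ) = 0 := by
  have hm' : (m:ℝ) ≠ 0 := by exact_mod_cast hm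
  rw [intervalIntegral.integral_comp_mul_add (f := cos) hm', integral_cos]
  have : (m:ℝ) * (2 * π) + θ = θ + m * (2 * π) := by ring
  rw [this, Real.sin_add_int_mul_two_pi]; simp

theorem int_cos_cos (k : ℕ) (τ : ℝ) :
    ∫ σ in (0:ℝ)..(2 * π), cos (k * (σ + τ)) * cos σ = if k = 1 then π * cos τ else 0 := by
  have e : ∀ σ : ℝ, cos (k * (σ + τ)) * cos σ =
      (1 / 2) * (cos (((k + 1 : ℤ) : ℝ) * σ + k * τ) + cos (((k - 1 : ℤ) : ℝ) * σ + k * τ)) := by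
    intro σ
    have e1 : (((k + 1 : ℤ) : ℝ) * σ + k * τ) = k * (σ + τ) + σ := by push_cast; ring
    have e2 : (((k - 1 : ℤ) : ℝ) * σ + k * τ) = k * (σ + τ) - σ := by push_cast; ring
    rw [e1, e2, Real.cos_add, Real.cos_sub]; ring
  simp_rw [e]
  rw [intervalIntegral.integral_const_mul, intervalIntegral.integral_add
    (Continuous.intervalIntegrable (by fun_prop) _ _) (Continuous.intervalIntegrable (by fun_prop) _ _),
    int_cos_lin _ _ (by omega)]
  split_ifs with h
  · subst h; simp; ring
  · rw [int_cos_lin _ _ (by omega)]; simp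

theorem phi_fourier (α τ : ℝ) (c : V) :
    ∫ σ in (0:ℝ)..(2 * π), phi α (σ + τ) c * cos σ = c 1 / 4 * (π * cos τ) := by
  have h := intervalIntegral.hasSum_integral_of_dominated_convergence (μ := volume) (a := 0) (b := 2 * π)
    (F := fun (k : ℕ) σ => c k * (wk α k * cos (k * (σ + τ))) * cos σ)
    (f := fun σ => phi α (σ + τ) c * cos σ) (fun k _ => ‖c k‖)
    (fun k => Continuous.aestronglyMeasurable (by fun_prop))
    (fun k => Eventually.of_forall fun σ _ => by
      rw [norm_mul, norm_mul, norm_mul, Real.norm_of_nonneg (wk_pos α k).le]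
      have h1 := wk_le α k
      have h2 : ‖cos (k * (σ + τ))‖ ≤ 1 := abs_cos_le_one _
      have h3 : ‖cos σ‖ ≤ 1 := abs_cos_le_one _
      calc ‖c k‖ * (wk α k * ‖cos (k * (σ + τ))‖) * ‖cos σ‖ ≤ ‖c k‖ * (1 * 1) * 1 := by gcongr
        _ = _ := by ring)
    (Eventually.of_forall fun σ _ => l1_summable c)
    (by simp)
    (Eventually.of_forall fun σ _ => (phi_hasSum α (σ + τ) c).mul_right (cos σ))
  have e : ∀ k : ℕ, ∫ σ in (0:ℝ)..(2 * π), c k * (wk α k * cos (k * (σ + τ))) * cos σ =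
      if k = 1 then c 1 / 4 * (π * cos τ) else 0 := by
    intro k
    have : ∀ σ : ℝ, c k * (wk α k * cos (k * (σ + τ))) * cos σ = (c k * wk α k) * (cos (k * (σ + τ)) * cos σ) := by
      intro σ; ring
    simp_rw [this]
    rw [intervalIntegral.integral_const_mul, int_cos_cos]
    split_ifs with h
    · subst h
      simp [wk, nk]; left; ring
    · simp
  simp_rw [e] at h
  exact h.unique (hasSum_ite_eq 1 _)

theorem coord_apply (k : ℕ) (c : V) : coord k c = c k := by
  have h := rlift_hasSum (fun j => if j = k then (1:ℝ) else 0) 1 (fun j => by split_ifs <;> simp) c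
  refine h.unique ?_
  have e : (fun j => c j • if j = k then (1:ℝ) else 0) = fun j => if j = k then c k else 0 := by
    ext j
    by_cases h : j = k
    · subst h; simp
    · simp [h]
  rw [e]
  exact hasSum_ite_eq k (c k)

theorem Pc_apply_one (c : V) : (Pc c : V) 1 = 0 := by
  rw [← coord_apply]
  simp [Pc, coord_single]

theorem bb_apply_one (c : V) : (b1 + Pc c : V) 1 = 4 := by
  rw [← coord_apply, map_add, coord_apply 1 (Pc c), Pc_apply_one, b1, coord_single]; simp

theorem phi_bb (α σ : ℝ) (c : V) : phi α σ (b1 + Pc c) = cos σ + phi α σ (Pc c) := by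
  rw [map_add, phi_b1]

end
end DB

namespace DB
noncomputable section

theorem bb_fourier (α τ : ℝ) (c : V) :
    ∫ σ in (0:ℝ)..(2 * π), phi α (σ + τ) (b1 + Pc c) * cos σ = π * cos τ := by
  rw [phi_fourier, bb_apply_one]; ring

/-- profile -/
def prof (α R l a : ℝ) (c : V) (s : ℝ) : ℝ := R + a / l * phi α (l * s) (b1 + Pc c)

theorem prof_periodic (α R : ℝ) {l : ℝ} (hl : 0 < l) (a : ℝ) (c : V) :
    Function.Periodic (prof α R l a c) (2 * π / l) := by
  intro s
  have e : l * (s + 2 * π / l) = l * s + 2 * π := by field_simp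
  simp only [prof]
  rw [e]
  have := phi_periodic α (b1 + Pc c) (l * s)
  simp only at this
  rw [this]

theorem prof_min (α R : ℝ) {l : ℝ} (hl : 0 < l) {a : ℝ} (ha : a ≠ 0) (c : V) {T : ℝ} (hT : 0 < T)
    (h : Function.Periodic (prof α R l a c) T) : 2 * π / l ≤ T := by
  have h1 : ∀ σ, phi α (σ + l * T) (b1 + Pc c) = phi α σ (b1 + Pc c) := by
    intro σ
    have := h (σ / l)
    simp only [prof] at this
    have e1 : l * (σ / l + T) = σ + l * T := by field_simp
    have e2 : l * (σ / l) = σ := by field_simp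
    rw [e1, e2] at this
    have hal : a / l ≠ 0 := div_ne_zero ha hl.ne'
    exact mul_left_cancel₀ hal (add_left_cancel this)
  have h2 := bb_fourier α (l * T) c
  have h3 := bb_fourier α 0 c
  simp_rw [h1] at h2
  simp only [add_zero, cos_zero, mul_one] at h3
  rw [h3] at h2
  have h4 : cos (l * T) = 1 := by
    have := mul_left_cancel₀ pi_pos.ne' (show π * cos (l * T) = π * 1 by rw [← h2, mul_one])
    exact this
  obtain ⟨n, hn⟩ := (Real.cos_eq_one_iff _).1 h4
  have hlT : 0 < l * T := mul_pos hl hT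
  have hn0 : 0 < n := by
    by_contra hc
    have : (n:ℝ) ≤ 0 := by exact_mod_cast not_lt.1 hc
    nlinarith [pi_pos]
  have hn1 : (1:ℝ) ≤ n := by exact_mod_cast hn0
  rw [div_le_iff₀ hl]
  nlinarith [pi_pos]

theorem prof_zero (α R l : ℝ) (c : V) (s : ℝ) : prof α R l 0 c s = R := by simp [prof]

theorem prof_zero_ne (α R l : ℝ) (c : V) {l' a' : ℝ} (hl' : 0 < l') (ha' : a' ≠ 0) (c' : V) :
    prof α R l 0 c ≠ prof α R l' a' c' := by
  intro h
  have hp : Function.Periodic (prof α R l' a' c') (π / l') := by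
    rw [← h]; intro s; rw [prof_zero, prof_zero]
  have := prof_min α R hl' ha' c' (by positivity) hp
  rw [div_le_div_iff_of_pos_right hl'] at this
  linarith [pi_pos]

theorem prof_inj (α R : ℝ) {l l' a a' : ℝ} (hl : 0 < l) (hl' : 0 < l') (hne : a ≠ a') (c c' : V) :
    prof α R l a c ≠ prof α R l' a' c' := by
  by_cases ha : a = 0
  · subst ha; exact prof_zero_ne α R l c hl' (Ne.symm hne) c'
  by_cases ha' : a' = 0
  · subst ha'; exact (prof_zero_ne α R l' c' hl hne c).symm
  intro h
  have p1 := prof_periodic α R hl a c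
  have p2 := prof_periodic α R hl' a' c'
  have q1 := prof_min α R hl ha c (T := 2 * π / l') (by positivity) (by rw [h]; exact p2)
  have q2 := prof_min α R hl' ha' c' (T := 2 * π / l) (by positivity) (by rw [← h]; exact p1)
  have e : 2 * π / l = 2 * π / l' := le_antisymm q1 q2
  have e' : l = l' := by
    rw [div_eq_div_iff hl.ne' hl'.ne'] at e
    exact (mul_left_cancel₀ (by positivity) e).symm
  subst e'
  have h1 : ∀ σ, a * (phi α (σ + 0) (b1 + Pc c) * cos σ) = a' * (phi α (σ + 0) (b1 + Pc c') * cos σ) := by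
    intro σ
    have := congrFun h (σ / l)
    simp only [prof] at this
    have e2 : l * (σ / l) = σ := by field_simp
    rw [e2] at this
    have := add_left_cancel this
    field_simp at this
    rw [add_zero]
    linear_combination cos σ * this
  have h2 : ∫ σ in (0:ℝ)..(2 * π), a * (phi α (σ + 0) (b1 + Pc c) * cos σ) =
     ∫ σ in (0:ℝ)..(2 * π), a' * (phi α (σ + 0) (b1 + Pc c') * cos σ) := by simp_rw [h1]
  rw [intervalIntegral.integral_const_mul, intervalIntegral.integral_const_mul, bb_fourier, bb_fourier] at h2
  simp only [cos_zero, mul_one] at h2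
  exact hne (mul_right_cancel₀ pi_pos.ne' h2)

end
end DB

/-- **Delaunay-type bands with constant nonlocal mean curvature in the plane.** For every
`α ∈ (0,1)` there are `R > 0`, `ν > 0`, `β ∈ (α,1)`, a continuous `λ : (−ν,ν) → (0,∞)` with
`λ(0) = 1`, and even `2π`-periodic functions `v_a ∈ C^{1,β}(ℝ)` orthogonal to `cos` with
`‖v_a‖_{C^{1,β}} → 0` as `a → 0`, such that the functions
`u_a(s) = R + (a/λ(a)) (cos(λ(a)s) + v_a(λ(a)s))` are positive, all the bands
`{−u_a(s₁) < s₂ < u_a(s₁)}` have the same constant nonlocal mean curvature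
`h_R = −2∫_ℝ (F(2R/|t|) − F(∞))|t|^{−1−α} dt > 0`, `u_a` has minimal period `2π/λ(a)` for
`a ≠ 0`, and `u_a ≠ u_{a'}` for `a ≠ a'`. -/
theorem delaunay_bands_constant_nonlocal_mean_curvature
    (α : ℝ) (hα : α ∈ Set.Ioo (0:ℝ) 1) :
    ∃ (R ν β : ℝ) (lam : ℝ → ℝ) (v : ℝ → ℝ → ℝ),
      0 < R ∧ 0 < ν ∧ β ∈ Set.Ioo α 1 ∧
      -- h_R is a positive constant depending only on α
      (0 < -2 * ∫ t : ℝ, (Fa α (2 * R / |t|) - FaInf α) * |t| ^ (-(1 + α))) ∧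
      -- λ is continuous and positive, with λ(0) = 1
      ContinuousOn lam (Set.Ioo (-ν) ν) ∧ (∀ a ∈ Set.Ioo (-ν) ν, 0 < lam a) ∧ lam 0 = 1 ∧
      -- each v_a is an even 2π-periodic C^{1,β} function orthogonal to cos
      (∀ a ∈ Set.Ioo (-ν) ν,
        Function.Periodic (v a) (2 * π) ∧ (∀ σ, v a (-σ) = v a σ) ∧
        ContDiff ℝ 1 (v a) ∧
        (∃ M : ℝ, ∀ σ σ', |deriv (v a) σ - deriv (v a) σ'| ≤ M * |σ - σ'| ^ β) ∧
        (∫ σ in (0:ℝ)..(2 * π), v a σ * Real.cos σ) = 0) ∧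
      -- ‖v_a‖_{C^{1,β}(ℝ)} → 0 as a → 0
      (∀ ε > (0:ℝ), ∃ δ > (0:ℝ), ∀ a ∈ Set.Ioo (-ν) ν, |a| < δ →
        (∀ σ, |v a σ| ≤ ε) ∧ (∀ σ, |deriv (v a) σ| ≤ ε) ∧
        (∀ σ σ', |deriv (v a) σ - deriv (v a) σ'| ≤ ε * |σ - σ'| ^ β)) ∧
      -- properties of the profiles u_a
      (∀ a ∈ Set.Ioo (-ν) ν, ∀ u : ℝ → ℝ,
        (∀ s, u s = R + (a / lam a) * (Real.cos (lam a * s) + v a (lam a * s))) →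
          (∀ s, 0 < u s) ∧
          -- constant nonlocal mean curvature h_R
          (∀ s, HasNMC α u s
            (-2 * ∫ t : ℝ, (Fa α (2 * R / |t|) - FaInf α) * |t| ^ (-(1 + α)))) ∧
          -- for a ≠ 0, the minimal positive period of u_a is 2π/λ(a)
          (a ≠ 0 → Function.Periodic u (2 * π / lam a) ∧
            ∀ T : ℝ, 0 < T → Function.Periodic u T → 2 * π / lam a ≤ T)) ∧
      -- distinct parameters give distinct profiles
      (∀ a ∈ Set.Ioo (-ν) ν, ∀ a' ∈ Set.Ioo (-ν) ν, a ≠ a' →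
        (fun s => R + (a / lam a) * (Real.cos (lam a * s) + v a (lam a * s))) ≠
          (fun s => R + (a' / lam a') * (Real.cos (lam a' * s) + v a' (lam a' * s)))) := by
  obtain ⟨x0, hx, h0⟩ := DB.exists_radius hα
  obtain ⟨c, hc0, hev⟩ := DB.exists_branch hα hx h0
  have hcc : ContinuousAt c 0 := hev.self_of_nhds.1
  set lam : ℝ → ℝ := fun a => (x0 + DB.coord 1 (c a)) / x0 with hlam
  have hlc : ∀ a, ContinuousAt c a → ContinuousAt lam a := fun a h =>
    (continuousAt_const.add ((DB.coord 1).continuous.continuousAt.comp h)).div_const x0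
  have hl0 : lam 0 = 1 := by simp [hlam, hc0, hx.ne']
  have hPc : ∀ a, ContinuousAt c a → ContinuousAt (fun a => DB.Pc (c a)) a := fun a h =>
    DB.Pc.continuous.continuousAt.comp h
  have hPc0 : DB.Pc (c 0) = 0 := by rw [hc0, map_zero]
  have e1 : ∀ᶠ a in 𝓝 0, 0 < lam a :=
    (hlc 0 hcc).eventually (lt_mem_nhds (by rw [hl0]; exact one_pos))
  have e2 : ∀ᶠ a in 𝓝 0, |a / lam a| * ‖DB.b1 + DB.Pc (c a)‖ < x0 / 2 := by
    have hct : ContinuousAt (fun a => |a / lam a| * ‖DB.b1 + DB.Pc (c a)‖) 0 :=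
      ((continuousAt_id.div (hlc 0 hcc) (by rw [hl0]; exact one_ne_zero)).abs).mul
        ((continuousAt_const.add (hPc 0 hcc)).norm)
    exact hct.eventually (gt_mem_nhds (by simp; exact hx))
  obtain ⟨ν, hν, hall⟩ := Metric.eventually_nhds_iff.1 (hev.and (e1.and e2))
  have hin : ∀ a ∈ Set.Ioo (-ν) ν, dist a 0 < ν := fun a ha => by
    rw [Real.dist_eq, sub_zero, abs_lt]; exact ha
  have hprof : ∀ a, (fun s => x0 / 2 + (a / lam a) * (Real.cos (lam a * s) + DB.phi α (lam a * s) (DB.Pc (c a)))) =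
      DB.prof α (x0 / 2) (lam a) a (c a) := by
    intro a; ext s; rw [DB.prof, DB.phi_bb]
  have h2R : 2 * (x0 / 2) = x0 := by ring
  refine ⟨x0 / 2, ν, (1 + α) / 2, lam, fun a σ => DB.phi α σ (DB.Pc (c a)), by positivity, hν,
    ⟨by linarith [hα.2], by linarith [hα.2]⟩, ?_, ?_, fun a ha => (hall (hin a ha)).2.1, hl0, ?_, ?_, ?_, ?_⟩
  · rw [h2R]; exact DB.hR_pos hα hx
  · intro a ha
    exact (hlc a (hall (hin a ha)).1.1).continuousWithinAt
  · intro a ha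
    refine ⟨DB.phi_periodic α _, fun σ => DB.phi_neg α σ _, DB.phi_contDiff α _, ⟨4 * ‖DB.Pc (c a)‖, fun σ σ' => ?_⟩, ?_⟩
    · rw [DB.phi_deriv']
      exact DB.dphi_holder α σ σ' _ (by linarith [hα.1]) (by linarith [hα.2])
    · have := DB.phi_fourier α 0 (DB.Pc (c a))
      simpa [DB.Pc_apply_one] using this
  · intro ε hε
    have hct : ContinuousAt (fun a => 4 * ‖DB.Pc (c a)‖) 0 := continuousAt_const.mul (hPc 0 hcc).norm
    have hev2 : ∀ᶠ a in 𝓝 0, 4 * ‖DB.Pc (c a)‖ < ε := hct.eventually (gt_mem_nhds (by simp [hPc0]; exact hε))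
    obtain ⟨δ, hδ, hδ'⟩ := Metric.eventually_nhds_iff.1 hev2
    refine ⟨δ, hδ, fun a _ had => ?_⟩
    have hb := hδ' (show dist a 0 < δ by rwa [Real.dist_eq, sub_zero])
    have hn := norm_nonneg (DB.Pc (c a))
    refine ⟨fun σ => ?_, fun σ => ?_, fun σ σ' => ?_⟩
    · have := DB.phi_bound α σ (DB.Pc (c a)); linarith
    · rw [DB.phi_deriv']
      have := DB.dphi_bound α σ (DB.Pc (c a)); simp only; linarith
    · rw [DB.phi_deriv']
      refine (DB.dphi_holder α σ σ' _ (β := (1 + α) / 2) (by linarith [hα.1]) (by linarith [hα.2])).trans ?_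
      gcongr
  · intro a ha u hu
    obtain ⟨⟨-, hE, hK1, hK2⟩, hlp, hsm⟩ := hall (hin a ha)
    have hu' : u = DB.prof α (x0 / 2) (lam a) a (c a) := by rw [← hprof]; exact funext hu
    subst hu'
    refine ⟨fun s => ?_, fun s => ?_, fun ha0 => ⟨DB.prof_periodic α _ hlp a _, fun T hT hp => DB.prof_min α _ hlp ha0 _ hT hp⟩⟩
    · have h1 := DB.phi_bound α (lam a * s) (DB.b1 + DB.Pc (c a))
      have h2 : |a / lam a * DB.phi α (lam a * s) (DB.b1 + DB.Pc (c a))| < x0 / 2 := by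
        rw [abs_mul]
        exact (mul_le_mul_of_nonneg_left h1 (abs_nonneg _)).trans_lt hsm
      have := (abs_lt.1 h2).1
      rw [DB.prof]; linarith
    · rw [h2R]
      have hd : 0 < x0 + DB.coord 1 (c a) := by
        have := mul_pos hlp hx
        simp only [hlam] at this
        rwa [div_mul_cancel₀ _ hx.ne'] at this
      exact DB.hasNMC_branch hα hx hK1 hK2 hd hE s
  · intro a ha a' ha' hne
    have := DB.prof_inj α (x0 / 2) (hall (hin a ha)).2.1 (hall (hin a' ha')).2.1 hne (c a) (c a')
    rw [← hprof, ← hprof] at this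
    exact this
end

section
/- Let α ∈ (0,1) and R > 0, and for each nonnegative integer k define λ_k(R) = ∫_ℝ (1 − cos(kt)) |t|^{−2−α} dt − ∫_ℝ (1 + cos(kt)) ( 1 + (2R/|t|)² )^{−(2+α)/2} |t|^{−2−α} dt. Then λ_k(R) / k^{1+α} → μ_∞ as k → ∞, where μ_∞ := ∫_ℝ (1 − cos t) |t|^{−2−α} dt, and μ_∞ > 0. -/
open MeasureTheory Filter Topology Real

/-- `λ_k(R) = ∫_ℝ (1−cos(kt))|t|^{−2−α} dt − ∫_ℝ (1+cos(kt))(1+(2R/|t|)²)^{−(2+α)/2}|t|^{−2−α} dt`. -/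
noncomputable def lamK (α R : ℝ) (k : ℕ) : ℝ :=
  (∫ t : ℝ, (1 - Real.cos (k * t)) * |t| ^ (-(2 + α))) -
    ∫ t : ℝ, (1 + Real.cos (k * t)) * (1 + (2 * R / |t|) ^ 2) ^ (-(2 + α) / 2) * |t| ^ (-(2 + α))

lemma aux_integrable (α : ℝ) (h0 : 0 < α) (h1 : α < 1) :
    Integrable (fun t : ℝ => (1 - Real.cos t) * |t| ^ (-(2 + α))) := by
  have hm : Measurable (fun t : ℝ => (1 - Real.cos t) * |t| ^ (-(2 + α))) := by fun_prop
  have hI : IntegrableOn (fun t : ℝ => (1 - Real.cos t) * |t| ^ (-(2 + α))) (Set.Ioi 0) := by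
    rw [← Set.Ioc_union_Ioi_eq_Ioi (zero_le_one (α := ℝ))]
    refine IntegrableOn.union ?_ ?_
    · have hi : IntegrableOn (fun t : ℝ => t ^ (-α)) (Set.Ioc 0 1) := by
        rw [← intervalIntegrable_iff_integrableOn_Ioc_of_le zero_le_one]
        exact intervalIntegral.intervalIntegrable_rpow' (by linarith)
      refine Integrable.mono' hi hm.aestronglyMeasurable ?_
      refine (ae_restrict_iff' measurableSet_Ioc).2 (ae_of_all _ fun t ht => ?_)
      have hp : (0:ℝ) < t := ht.1
      have hc := Real.one_sub_sq_div_two_le_cos (x := t)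
      have hc1 := Real.cos_le_one t
      have hq : (0:ℝ) ≤ t ^ (-(2 + α)) := by positivity
      rw [abs_of_pos hp, Real.norm_of_nonneg (mul_nonneg (by linarith) hq)]
      have : t ^ (-α) = t ^ 2 * t ^ (-(2 + α)) := by
        rw [← Real.rpow_natCast, ← Real.rpow_add hp]; congr 1; push_cast; ring
      rw [this]
      exact mul_le_mul_of_nonneg_right (by nlinarith) hq
    · have hi : IntegrableOn (fun t : ℝ => 2 * t ^ (-(2 + α))) (Set.Ioi 1) :=
        (integrableOn_Ioi_rpow_of_lt (by linarith) one_pos).const_mul 2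
      refine Integrable.mono' hi hm.aestronglyMeasurable ?_
      refine (ae_restrict_iff' measurableSet_Ioi).2 (ae_of_all _ fun t ht => ?_)
      have hp : (0:ℝ) < t := lt_trans one_pos ht
      have hc := Real.neg_one_le_cos t
      have hc1 := Real.cos_le_one t
      have hq : (0:ℝ) ≤ t ^ (-(2 + α)) := by positivity
      rw [abs_of_pos hp, Real.norm_of_nonneg (mul_nonneg (by linarith) hq)]
      exact mul_le_mul_of_nonneg_right (by linarith) hq
  have hI2 : IntegrableOn (fun t : ℝ => (1 - Real.cos t) * |t| ^ (-(2 + α))) (Set.Iic 0) := by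
    rw [integrableOn_Iic_iff_integrableOn_Iio]
    have h := IntegrableOn.comp_neg_Iio (c := (0:ℝ)) (by rw [neg_zero]; exact hI)
    simpa only [Real.cos_neg, abs_neg] using h
  rw [← integrableOn_univ, ← Set.Iic_union_Ioi (a := (0:ℝ))]
  exact hI2.union hI

lemma aux_pos (α : ℝ) (h0 : 0 < α) (h1 : α < 1) :
    0 < ∫ t : ℝ, (1 - Real.cos t) * |t| ^ (-(2 + α)) := by
  rw [integral_pos_iff_support_of_nonneg _ (aux_integrable α h0 h1)]
  · have hsub : Set.Ioo (0:ℝ) 1 ⊆ Function.support (fun t : ℝ => (1 - Real.cos t) * |t| ^ (-(2 + α))) := by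
      intro t ht
      have h2 : Real.cos t < 1 := by
        rw [← Real.cos_zero]
        exact Real.cos_lt_cos_of_nonneg_of_le_pi le_rfl (by linarith [ht.2, Real.pi_gt_three]) ht.1
      have h3 : 0 < |t| := abs_pos.2 ht.1.ne'
      have : 0 < (1 - Real.cos t) * |t| ^ (-(2 + α)) :=
        mul_pos (by linarith) (Real.rpow_pos_of_pos h3 _)
      exact this.ne'
    refine lt_of_lt_of_le ?_ (measure_mono hsub)
    simp
  · intro t
    exact mul_nonneg (by linarith [Real.cos_le_one t]) (by positivity)

lemma aux_scale (α : ℝ) (k : ℕ) (hk : 0 < k) :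
    ∫ t : ℝ, (1 - Real.cos (k * t)) * |t| ^ (-(2 + α)) =
      (k : ℝ) ^ (1 + α) * ∫ t : ℝ, (1 - Real.cos t) * |t| ^ (-(2 + α)) := by
  have hk' : (0:ℝ) < k := by exact_mod_cast hk
  have h := Measure.integral_comp_mul_left (fun t : ℝ => (1 - Real.cos t) * |t| ^ (-(2 + α))) (k:ℝ)
  have e : ∀ t : ℝ, (1 - Real.cos (k * t)) * |t| ^ (-(2 + α)) =
      (k:ℝ) ^ (2 + α) * ((1 - Real.cos (k * t)) * |k * t| ^ (-(2 + α))) := by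
    intro t
    rw [abs_mul, abs_of_pos hk', Real.mul_rpow hk'.le (abs_nonneg t), Real.rpow_neg hk'.le]
    have : (k:ℝ) ^ (2 + α) ≠ 0 := by positivity
    field_simp
  simp_rw [e]
  rw [integral_const_mul, h, abs_of_pos (by positivity), smul_eq_mul, ← mul_assoc]
  congr 1
  rw [← Real.rpow_neg_one, ← Real.rpow_add hk']; congr 1; ring

lemma aux_bound (α R : ℝ) (h0 : 0 < α) (hR : 0 < R) : ∃ C : ℝ, ∀ k : ℕ,
    ‖∫ t : ℝ, (1 + Real.cos (k * t)) * (1 + (2 * R / |t|) ^ 2) ^ (-(2 + α) / 2) * |t| ^ (-(2 + α))‖ ≤ C := by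
  have hi : Integrable (fun t : ℝ => (1 + ‖t‖ ^ 2) ^ (-(2 + α) / 2)) :=
    integrable_rpow_neg_one_add_norm_sq (by simp; linarith)
  have hi2 := ((hi.comp_div (R := 2 * R) (by positivity)).const_mul (2 * (2 * R) ^ (-(2 + α))))
  refine ⟨_, fun k => norm_integral_le_of_norm_le hi2 (ae_of_all _ fun t => ?_)⟩
  have hc := Real.neg_one_le_cos (k * t)
  have hc1 := Real.cos_le_one (k * t)
  rw [Real.norm_of_nonneg (by
    refine mul_nonneg (mul_nonneg (by linarith) (by positivity)) (by positivity)), mul_assoc, mul_assoc]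
  refine mul_le_mul (by linarith) ?_ (by positivity) (by norm_num)
  rcases eq_or_ne t 0 with rfl | ht
  · rw [abs_zero, Real.zero_rpow (by linarith), mul_zero]; positivity
  · have ha : 0 < |t| := abs_pos.2 ht
    have key : ∀ x : ℝ, 0 < x → x ^ (-(2 + α)) = (x ^ 2) ^ (-(2 + α) / 2) := by
      intro x hx
      rw [← Real.rpow_natCast, ← Real.rpow_mul hx.le]; congr 1; push_cast; ring
    rw [key _ ha, key (2 * R) (by positivity), ← Real.mul_rpow (by positivity) (by positivity),
      ← Real.mul_rpow (by positivity) (by positivity)]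
    apply le_of_eq
    congr 1
    rw [Real.norm_eq_abs, abs_div, abs_of_pos (show 0 < 2 * R by positivity)]
    field_simp
    try ring

/-- **Asymptotics of the eigenvalues:** `λ_k(R)/k^{1+α} → μ_∞ = ∫_ℝ (1−cos t)|t|^{−2−α} dt > 0`
as `k → ∞`, for every `α ∈ (0,1)` and `R > 0`. -/
theorem eigenvalues_asymptotics
    (α R : ℝ) (hα : α ∈ Set.Ioo (0:ℝ) 1) (hR : 0 < R) :
    0 < ∫ t : ℝ, (1 - Real.cos t) * |t| ^ (-(2 + α)) ∧
    Tendsto (fun k : ℕ => lamK α R k / (k : ℝ) ^ (1 + α)) atTop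
      (𝓝 (∫ t : ℝ, (1 - Real.cos t) * |t| ^ (-(2 + α)))) := by
  obtain ⟨h0, h1⟩ := hα
  refine ⟨aux_pos α h0 h1, ?_⟩
  obtain ⟨C, hC⟩ := aux_bound α R h0 hR
  have hk : Tendsto (fun k : ℕ => (k : ℝ) ^ (1 + α)) atTop atTop :=
    (tendsto_rpow_atTop (by linarith)).comp tendsto_natCast_atTop_atTop
  have hz : Tendsto (fun k : ℕ => (∫ t : ℝ, (1 + Real.cos (k * t)) *
      (1 + (2 * R / |t|) ^ 2) ^ (-(2 + α) / 2) * |t| ^ (-(2 + α))) / (k : ℝ) ^ (1 + α))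
      atTop (𝓝 0) := by
    refine squeeze_zero_norm (fun k => ?_) (hk.const_div_atTop C)
    rw [norm_div, Real.norm_of_nonneg (show (0:ℝ) ≤ (k:ℝ) ^ (1 + α) by positivity)]
    exact div_le_div_of_nonneg_right (hC k) (by positivity)
  have hf := (tendsto_const_nhds (x := ∫ t : ℝ, (1 - Real.cos t) * |t| ^ (-(2 + α)))).sub hz
  rw [sub_zero] at hf
  refine hf.congr' ?_
  filter_upwards [eventually_gt_atTop 0] with k hk0
  have hk' : (0:ℝ) < k := by exact_mod_cast hk0
  have : (k:ℝ) ^ (1 + α) ≠ 0 := by positivity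
  rw [lamK, aux_scale α k hk0, sub_div, mul_div_cancel_left₀ _ this]
end
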